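/- arXiv:1905.07715 — 3 statements merged into one kernel-verified Lean document; each statement's English description precedes it below -/
import Mathlib

section
/- Let d ≥ 1 and r ≥ 2 be integers and set N = (r−1)(d+1). Let a : Δ_N → ℝ^d be an affine map (equivalently, an assignment of a point a(v_i) ∈ ℝ^d to each of the N+1 vertices v_0,…,v_N of Δ_N, extended affinely). Let μ be a face of Δ_N of dimension at most r−2 (that is, card(vert(μ)) ≤ r−1) such that a(μ) ∩ a(μ') = ∅, where a(μ) denotes the convex hull of {a(v) : v ∈ vert(μ)} and μ' is the complementary face. Then there exist r pairwise disjoint nonempty proper faces σ_1,…,σ_r of Δ_N, a point b ∈ ℝ^d, and real coefficients α_v for v ∈ vert(σ_1) ∪ … ∪ vert(σ_r), such that for every j ∈ {1,…,r}: b = Σ_{v ∈ vert(σ_j)} α_v a(v) and Σ_{v ∈ vert(σ_j)} α_v = 1 (so b lies in aff(a(σ_1)) ∩ … ∩ aff(a(σ_r))), and moreover α_v ≤ 0 for every v ∈ vert(μ) and α_v ≥ 0 for every v ∈ vert(μ'). -/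
open scoped RealInnerProductSpace in
/-- First-order optimality: if `p` has minimal norm on the segment from `p` to `q`, then
`‖p‖² ≤ ⟪p, q⟫`. -/
theorem sq_norm_le_inner_of_norm_le_segment {E : Type*} [NormedAddCommGroup E]
    [InnerProductSpace ℝ E] {p q : E}
    (h : ∀ t : ℝ, 0 < t → t ≤ 1 → ‖p‖ ≤ ‖p + t • (q - p)‖) : ‖p‖ ^ 2 ≤ ⟪p, q⟫ := by
  by_contra! hlt
  have hc : ⟪p, q - p⟫ < 0 := by
    rw [inner_sub_right, real_inner_self_eq_norm_sq]; linarith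
  have hne : q - p ≠ 0 := by
    rintro h0
    simp [h0] at hc
  have hD : 0 < ‖q - p‖ ^ 2 := by positivity
  set c := ⟪p, q - p⟫
  set D := ‖q - p‖ ^ 2 with hDdef
  have ht0 : 0 < min 1 (-c / D) := lt_min one_pos (div_pos (by linarith) hD)
  have ht2 : min 1 (-c / D) * D ≤ -c := by
    rw [← le_div_iff₀ hD]; exact min_le_right _ _
  have h1 := h _ ht0 (min_le_left _ _)
  set t := min 1 (-c / D)
  have h2 : ‖p‖ ^ 2 ≤ ‖p + t • (q - p)‖ ^ 2 := by gcongr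
  have h3 : ‖p + t • (q - p)‖ ^ 2 = ‖p‖ ^ 2 + t * (2 * c + t * D) := by
    rw [norm_add_sq_real, norm_smul, inner_smul_right, mul_pow, Real.norm_eq_abs, sq_abs]
    ring
  nlinarith

/-- Among more than `dim E` points on an affine hyperplane `ℓ = m` with `m ≠ 0`, every strictly
positive convex combination can be rewritten so that some coefficient vanishes. -/
theorem exists_stdSimplex_sum_eq_and_eq_zero {E ι : Type*} [AddCommGroup E] [Module ℝ E]
    [FiniteDimensional ℝ E] [Fintype ι] (hcard : Module.finrank ℝ E < Fintype.card ι)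
    (x : ι → E) (ℓ : E →ₗ[ℝ] ℝ) {m : ℝ} (hm : m ≠ 0) (hx : ∀ i, ℓ (x i) = m)
    {w : ι → ℝ} (hw : w ∈ stdSimplex ℝ ι) :
    ∃ w' ∈ stdSimplex ℝ ι, ∑ i, w' i • x i = ∑ i, w i • x i ∧ ∃ i, w' i = 0 := by
  have hdep : ¬ LinearIndependent ℝ x := fun h => by
    have := h.fintype_card_le_finrank
    omega
  obtain ⟨c, hc, i₀, hi₀⟩ := Fintype.not_linearIndependent_iff.1 hdep
  have hsum : ∑ i, c i = 0 := by
    have h := congrArg ℓ hc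
    simp only [map_sum, map_smul, hx, smul_eq_mul, map_zero, ← Finset.sum_mul] at h
    exact (mul_eq_zero.1 h).resolve_right hm
  have hpos : ∃ i, 0 < c i := by
    by_contra! hle
    exact hi₀ ((Finset.sum_eq_zero_iff_of_nonpos fun i _ => hle i).1 hsum i₀ (Finset.mem_univ _))
  obtain ⟨i₁, hi₁⟩ := hpos
  obtain ⟨i, hi, hmin⟩ := Finset.exists_min_image (Finset.univ.filter fun i => 0 < c i)
    (fun i => w i / c i) ⟨i₁, by simpa using hi₁⟩
  simp only [Finset.mem_filter, Finset.mem_univ, true_and] at hi hmin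
  refine ⟨fun j => w j - w i / c i * c j, ⟨fun j => ?_, ?_⟩, ?_, i, ?_⟩
  · rcases lt_or_ge 0 (c j) with hj | hj
    · have := (le_div_iff₀ hj).1 (hmin j hj)
      linarith
    · have := mul_nonneg_of_nonpos_of_nonpos (neg_nonpos.2 (div_nonneg (hw.1 i) hi.le)) hj
      have := hw.1 j
      linarith
  · simp [Finset.sum_sub_distrib, ← Finset.mul_sum, hsum, hw.2]
  · simp [sub_smul, Finset.sum_sub_distrib, mul_smul, ← Finset.smul_sum, hc]
  · simp [hi.ne']

open scoped RealInnerProductSpace in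
/-- **Colorful Carathéodory theorem** (Bárány): given more than `dim E` finite families whose convex
hulls all contain the origin, some transversal has the origin in its convex hull. -/
theorem colorful_caratheodory {E ι κ : Type*} [NormedAddCommGroup E] [InnerProductSpace ℝ E]
    [FiniteDimensional ℝ E] [Fintype ι] [Finite κ]
    (hcard : Module.finrank ℝ E < Fintype.card ι) (x : ι → κ → E)
    (hx : ∀ i, 0 ∈ convexHull ℝ (Set.range (x i))) :
    ∃ f : ι → κ, ∃ w ∈ stdSimplex ℝ ι, ∑ i, w i • x i (f i) = 0 := by
  classical
  have hκ : ∀ i (p : E), ∃ k, ⟪p, x i k⟫ ≤ 0 := by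
    intro i p
    by_contra! h
    have hconv : Convex ℝ {y : E | 0 < ⟪p, y⟫} :=
      convex_halfSpace_gt (innerₛₗ ℝ p).isLinear 0
    have := convexHull_min (s := Set.range (x i)) (Set.range_subset_iff.2 h) hconv (hx i)
    simp at this
  have : Nonempty ι := Fintype.card_pos_iff.1 (by omega)
  have : Nonempty (ι → κ) := ⟨fun i => (hκ i 0).choose⟩
  have hmin : ∀ f : ι → κ, ∃ w ∈ stdSimplex ℝ ι,
      ∀ w' ∈ stdSimplex ℝ ι, ‖∑ i, w i • x i (f i)‖ ≤ ‖∑ i, w' i • x i (f i)‖ := by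
    intro f
    obtain ⟨i⟩ := ‹Nonempty ι›
    obtain ⟨w, hw, h⟩ := (isCompact_stdSimplex ℝ ι).exists_isMinOn
      ⟨_, single_mem_stdSimplex ℝ i⟩
      (f := fun w : ι → ℝ => ‖∑ i, w i • x i (f i)‖) (by fun_prop)
    exact ⟨w, hw, fun w' hw' => h hw'⟩
  choose W hW hWmin using hmin
  obtain ⟨f, hf⟩ := Finite.exists_min fun f : ι → κ => ‖∑ i, W f i • x i (f i)‖
  refine ⟨f, W f, hW f, ?_⟩
  set p := ∑ i, W f i • x i (f i) with hp
  by_contra hp0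
  have hopt : ∀ g : ι → κ, ∀ w ∈ stdSimplex ℝ ι, ∑ i, w i • x i (g i) = p →
      ∀ i, ‖p‖ ^ 2 ≤ ⟪p, x i (g i)⟫ := by
    intro g w hw hwp i
    refine sq_norm_le_inner_of_norm_le_segment fun t ht0 ht1 => ?_
    have hmem := convex_stdSimplex ℝ ι hw (single_mem_stdSimplex ℝ i)
      (sub_nonneg.2 ht1) ht0.le (sub_add_cancel 1 t)
    refine ((hf g).trans (hWmin g _ hmem)).trans_eq (congrArg _ ?_)
    simp only [Pi.add_apply, Pi.smul_apply, smul_eq_mul, add_smul, mul_smul,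
      Finset.sum_add_distrib, ← Finset.smul_sum, hwp, Pi.single_apply, ite_smul, one_smul,
      zero_smul, Finset.sum_ite_eq', Finset.mem_univ, if_true]
    module
  have hppos : 0 < ‖p‖ ^ 2 := by positivity
  have hzero : ∃ w ∈ stdSimplex ℝ ι, ∑ i, w i • x i (f i) = p ∧ ∃ i, w i = 0 := by
    by_cases h0 : ∃ i, W f i = 0
    · exact ⟨W f, hW f, rfl, h0⟩
    push Not at h0
    refine exists_stdSimplex_sum_eq_and_eq_zero hcard (fun i => x i (f i)) (innerₛₗ ℝ p)
      hppos.ne' (fun i => ?_) (hW f)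
    have hsum : ∑ i, W f i * (⟪p, x i (f i)⟫ - ‖p‖ ^ 2) = 0 := by
      have h : ⟪p, p⟫ = ∑ i, W f i * ⟪p, x i (f i)⟫ := by
        conv_lhs => rw [hp, inner_sum]
        simp [inner_smul_right, hp]
      simp only [mul_sub, Finset.sum_sub_distrib, ← h, ← Finset.sum_mul, (hW f).2,
        real_inner_self_eq_norm_sq]
      ring
    have := (Finset.sum_eq_zero_iff_of_nonneg fun i _ => mul_nonneg ((hW f).1 i)
      (sub_nonneg.2 (hopt f _ (hW f) rfl i))).1 hsum i (Finset.mem_univ i)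
    exact sub_eq_zero.1 ((mul_eq_zero.1 this).resolve_left (h0 i))
  obtain ⟨w, hw, hwp, i, hi⟩ := hzero
  obtain ⟨k, hk⟩ := hκ i p
  have := hopt (Function.update f i k) w hw (by
    rw [← hwp]
    refine Finset.sum_congr rfl fun j _ => ?_
    rcases eq_or_ne j i with rfl | hj
    · simp [hi]
    · rw [Function.update_of_ne hj]) i
  rw [Function.update_self] at this
  linarith

/-- **Sarkaria's lemma**, linear form of Tverberg's theorem: more than `s * dim` vectors can be
colored with `s + 1` colors and given convex weights so that all color classes have the same
weighted sum. -/
theorem exists_coloring_forall_weighted_sum_eq {ι κ : Type*} [Fintype ι] [Fintype κ] (s : ℕ)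
    (hcard : s * Fintype.card κ < Fintype.card ι) (y : ι → κ → ℝ) :
    ∃ f : ι → Fin (s + 1), ∃ w ∈ stdSimplex ℝ ι, ∀ j k c,
      ∑ v with f v = j, w v * y v c = ∑ v with f v = k, w v * y v c := by
  let x : ι → Fin (s + 1) → EuclideanSpace ℝ (Fin s × κ) := fun v j => WithLp.toLp 2 fun q =>
    ((if j = q.1.castSucc then 1 else 0) - (if j = Fin.last s then 1 else 0)) * y v q.2
  have hx : ∀ v, 0 ∈ convexHull ℝ (Set.range (x v)) := by
    intro v
    have h := Finset.univ.centerMass_mem_convexHull (R := ℝ) (w := fun _ : Fin (s + 1) => 1)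
      (fun _ _ => zero_le_one) (by simp; positivity) (fun j _ => Set.mem_range_self (f := x v) j)
    have h0 : ∑ j, x v j = 0 := by
      ext q
      simp [x, ← Finset.sum_mul, Finset.sum_sub_distrib]
    simpa [Finset.centerMass, h0] using h
  obtain ⟨f, w, hw, h⟩ := colorful_caratheodory (by simpa using hcard) x hx
  have hlast : ∀ j c, ∑ v with f v = j, w v * y v c = ∑ v with f v = Fin.last s, w v * y v c := by
    intro j c
    induction j using Fin.lastCases with
    | last => rfl
    | cast j =>
      have := congrArg (fun z : EuclideanSpace ℝ (Fin s × κ) => z (j, c)) h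
      simp only [x, WithLp.ofLp_sum, WithLp.ofLp_smul, Finset.sum_apply, Pi.smul_apply, sub_mul,
        smul_eq_mul, mul_sub, Finset.sum_sub_distrib, ite_mul, one_mul, zero_mul, mul_ite,
        mul_zero, ← Finset.sum_filter, PiLp.zero_apply] at this
      linarith
  exact ⟨f, w, hw, fun j k c => (hlast j c).trans (hlast k c).symm⟩

/-- If nonnegative weights, not all zero, have equal total mass and equal weighted sums on `μ` and
on `μᶜ`, then the convex hulls of the images of `μ` and `μᶜ` meet. -/
theorem convexHull_inter_convexHull_compl_nonempty {E ι : Type*} [AddCommGroup E] [Module ℝ E]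
    [Fintype ι] [DecidableEq ι] (a : ι → E) (μ : Finset ι) {w : ι → ℝ} (hw : w ∈ stdSimplex ℝ ι)
    (hmass : ∑ v ∈ μ, w v = ∑ v ∈ μᶜ, w v)
    (hsum : ∑ v ∈ μ, w v • a v = ∑ v ∈ μᶜ, w v • a v) :
    (convexHull ℝ (a '' ↑μ) ∩ convexHull ℝ (a '' ↑μᶜ)).Nonempty := by
  have htot := hw.2
  rw [← Finset.sum_add_sum_compl μ] at htot
  refine ⟨μ.centerMass w a, μ.centerMass_mem_convexHull (fun v _ => hw.1 v) (by linarith)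
    fun v hv => Set.mem_image_of_mem a hv, ?_⟩
  have : μ.centerMass w a = μᶜ.centerMass w a := by
    simp only [Finset.centerMass, hmass, hsum]
  rw [this]
  exact μᶜ.centerMass_mem_convexHull (fun v _ => hw.1 v) (by linarith)
    fun v hv => Set.mem_image_of_mem a hv



/-- **Tverberg plus minus theorem** (Bárány–Soberón).
Vertices of the simplex `Δ_N` are modeled by `Fin (N+1)`, faces by finsets of vertices,
and the affine map `a : Δ_N → ℝ^d` by its values on the vertices.
The face `μ` has dimension at most `r - 2`, i.e. at most `r - 1` vertices, and its image
`a(μ)` (the convex hull of the images of its vertices) is disjoint from the image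
`a(μ')` of the complementary face `μ' = μᶜ`. -/
theorem tverberg_plus_minus
    (d r : ℕ) (hd : 1 ≤ d) (hr : 2 ≤ r)
    (N : ℕ) (hN : N = (r - 1) * (d + 1))
    (a : Fin (N + 1) → EuclideanSpace ℝ (Fin d))
    (μ : Finset (Fin (N + 1))) (hμcard : μ.card ≤ r - 1)
    (hsep : convexHull ℝ (a '' ↑μ) ∩ convexHull ℝ (a '' ↑μᶜ) = ∅) :
    ∃ (σ : Fin r → Finset (Fin (N + 1))) (b : EuclideanSpace ℝ (Fin d))
      (α : Fin (N + 1) → ℝ),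
      (∀ j, (σ j).Nonempty) ∧
      (∀ j, σ j ≠ Finset.univ) ∧
      (∀ j k, j ≠ k → Disjoint (σ j) (σ k)) ∧
      (∀ j, ∑ v ∈ σ j, α v • a v = b) ∧
      (∀ j, ∑ v ∈ σ j, α v = 1) ∧
      (∀ v, (∃ j, v ∈ σ j) → (v ∈ μ → α v ≤ 0) ∧ (v ∉ μ → 0 ≤ α v)) := by
  obtain ⟨s, rfl⟩ : ∃ s, r = s + 1 := ⟨r - 1, by omega⟩
  simp only [Nat.add_sub_cancel] at hN hμcard
  let ε : Fin (N + 1) → ℝ := fun v => if v ∈ μ then -1 else 1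
  obtain ⟨f, w, hw, h⟩ := exists_coloring_forall_weighted_sum_eq (κ := Option (Fin d)) s
    (by simp [hN]) fun v c => ε v * c.elim 1 fun i => a v i
  have hmass : ∀ j k, ∑ v with f v = j, w v * ε v = ∑ v with f v = k, w v * ε v := by
    intro j k
    simpa using h j k none
  have hvec : ∀ j k, ∑ v with f v = j, (w v * ε v) • a v
      = ∑ v with f v = k, (w v * ε v) • a v := by
    intro j k
    ext i
    simpa [mul_assoc] using h j k (some i)
  obtain ⟨j₀, hj₀⟩ : ∃ j, j ∉ μ.image f := by
    by_contra! hall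
    have := Finset.card_le_card (fun j _ => hall j : Finset.univ ⊆ μ.image f)
    have := Finset.card_image_le (s := μ) (f := f)
    simp at *
    omega
  have hε : ∀ v, f v = j₀ → ε v = 1 := fun v hv =>
    if_neg fun hvμ => hj₀ (hv ▸ Finset.mem_image_of_mem f hvμ)
  have hj₀sum : ∑ v with f v = j₀, w v * ε v = ∑ v with f v = j₀, w v :=
    Finset.sum_congr rfl fun v hv => by rw [hε v (by simpa using hv), mul_one]
  set c := ∑ v with f v = j₀, w v * ε v with hc
  have hsplit : ∀ {M : Type} [AddCommGroup M] [Module ℝ M] (g : Fin (N + 1) → M),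
      ∑ v, (w v * ε v) • g v = ∑ v ∈ μᶜ, w v • g v - ∑ v ∈ μ, w v • g v := by
    intro M _ _ g
    rw [← Finset.sum_add_sum_compl μ, sub_eq_neg_add, ← Finset.sum_neg_distrib]
    congr 1
    · exact Finset.sum_congr rfl fun v hv => by simp [ε, hv]
    · exact Finset.sum_congr rfl fun v hv => by simp [ε, Finset.mem_compl.1 hv]
  have hcpos : 0 < c := by
    refine lt_of_le_of_ne (hj₀sum ▸ Finset.sum_nonneg fun v _ => hw.1 v) fun hc0 => ?_
    have hw0 : ∀ v, f v = j₀ → w v = 0 := by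
      rw [← hc0] at hj₀sum
      simpa using (Finset.sum_eq_zero_iff_of_nonneg fun v _ => hw.1 v).1 hj₀sum.symm
    have hvec0 : ∑ v with f v = j₀, (w v * ε v) • a v = 0 :=
      Finset.sum_eq_zero fun v hv => by simp [hw0 v (by simpa using hv)]
    have htotal : ∑ v, w v * ε v = 0 := by
      rw [← Finset.sum_fiberwise _ f]
      exact Finset.sum_eq_zero fun j _ => (hmass j j₀).trans hc0.symm
    have hvtotal : ∑ v, (w v * ε v) • a v = 0 := by
      rw [← Finset.sum_fiberwise _ f]
      exact Finset.sum_eq_zero fun j _ => (hvec j j₀).trans hvec0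
    have h1 := hsplit fun _ => (1 : ℝ)
    have h2 := hsplit a
    simp only [smul_eq_mul, mul_one, htotal] at h1
    rw [hvtotal] at h2
    have := convexHull_inter_convexHull_compl_nonempty a μ hw (sub_eq_zero.1 h1.symm).symm
      (sub_eq_zero.1 h2.symm).symm
    rw [hsep] at this
    exact Set.not_nonempty_empty this
  have hone : ∀ j, ∑ v with f v = j, c⁻¹ * (w v * ε v) = 1 := fun j => by
    rw [← Finset.mul_sum, hmass j j₀, ← hc, inv_mul_cancel₀ hcpos.ne']
  have hne : ∀ j, (Finset.univ.filter fun v => f v = j).Nonempty := fun j =>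
    Finset.nonempty_of_sum_ne_zero ((hone j).trans_ne one_ne_zero)
  have hdisj : ∀ j k, j ≠ k → Disjoint (Finset.univ.filter fun v => f v = j)
      (Finset.univ.filter fun v => f v = k) := fun j k hjk =>
    Finset.disjoint_filter.2 fun v _ hj hk => hjk (hj.symm.trans hk)
  refine ⟨fun j => Finset.univ.filter fun v => f v = j,
    c⁻¹ • ∑ v with f v = j₀, (w v * ε v) • a v, fun v => c⁻¹ * (w v * ε v), hne,
    fun j hj => ?_, hdisj, fun j => ?_, hone, fun v _ => ⟨fun hv => ?_, fun hv => ?_⟩⟩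
  · have : Nontrivial (Fin (s + 1)) := Fin.nontrivial_iff_two_le.2 hr
    obtain ⟨k, hk⟩ := exists_ne j
    obtain ⟨v, hv⟩ := hne k
    exact Finset.disjoint_left.1 (hdisj k j hk) hv ((Finset.ext_iff.1 hj v).2 (Finset.mem_univ v))
  · simp only [mul_smul c⁻¹, ← Finset.smul_sum, hvec j j₀]
  · have := mul_nonneg (inv_nonneg.2 hcpos.le) (hw.1 v)
    simp only [ε, if_pos hv]
    linarith
  · have := mul_nonneg (inv_nonneg.2 hcpos.le) (hw.1 v)
    simp only [ε, if_neg hv]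
    linarith
end

section
/- Let d ≥ 1 be an integer, let r ≥ 2 be a prime, and set N = (r−1)(d+1). Let a : Δ_N → ℝ^d be an affine map. Let μ be a face of Δ_N of dimension at most r−2 (that is, card(vert(μ)) ≤ r−1) such that a(μ) ∩ a(μ') = ∅, and suppose the vertex set of Δ_N is partitioned into m+1 color classes vert(Δ_N) = C_0 ⊔ … ⊔ C_m with card(C_i) ≤ r−1 for every 0 ≤ i ≤ m. Then there exist r pairwise disjoint nonempty proper faces σ_1,…,σ_r of Δ_N, a point b ∈ ℝ^d, and real coefficients α_v for v ∈ vert(σ_1) ∪ … ∪ vert(σ_r), such that for every j ∈ {1,…,r}: b = Σ_{v ∈ vert(σ_j)} α_v a(v) and Σ_{v ∈ vert(σ_j)} α_v = 1, with α_v ≤ 0 for every v ∈ vert(μ) and α_v ≥ 0 for every v ∈ vert(μ'), and in addition card(C_i ∩ vert(σ_j)) ≤ 1 for every 0 ≤ i ≤ m and every 1 ≤ j ≤ r (all the faces σ_1,…,σ_r are rainbow faces). -/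
namespace ColoredTverberg

open Matrix Finset Equiv

/-- The sign of a real number, as an element of a ring. -/
noncomputable def signHomTo (R : Type*) [Ring R] : ℝ →*₀ R :=
  (SignType.castHom : SignType →*₀ R).comp signHom

section Sign
variable {R : Type*} [Ring R]

lemma signHomTo_of_pos {x : ℝ} (hx : 0 < x) : signHomTo R x = 1 := by
  simp [signHomTo, signHom, sign_pos hx]

lemma signHomTo_of_neg {x : ℝ} (hx : x < 0) : signHomTo R x = -1 := by
  simp [signHomTo, signHom, sign_neg hx]

lemma signHomTo_intUnits (u : ℤˣ) : signHomTo R ((u : ℤ) : ℝ) = ((u : ℤ) : R) := by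
  rcases Int.units_eq_one_or u with rfl | rfl <;>
    simp [signHomTo_of_neg]

end Sign

lemma sum_ite_of_existsUnique {R ι : Type*} [CommRing R] [Fintype ι] {p : ι → Prop} [DecidablePred p]
    (h : ∃! i, p i) :
    ∑ i, (if p i then (1 : R) else 0) = 1 := by
  obtain ⟨i, hi, hu⟩ := h
  rw [Finset.sum_eq_single i]
  · simp [hi]
  · intro k _ hk
    rw [if_neg]
    exact fun h => hk (hu k h)
  · simp

section Exchange

variable {R : Type*} [CommRing R] {ι : Type*} [Fintype ι] [DecidableEq ι]

open Classical in
/-- The signed count of the facets of a nondegenerate simplex hit by a generic ray, in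
coordinates. -/
lemma sum_sign_exchange (a b : ι → ℝ) (ha : ∀ i, a i ≠ 0) (hb : ∀ i, b i ≠ 0)
    (hab : ∀ i k, i ≠ k → a k * b i ≠ a i * b k) :
    ∑ i, signHomTo R (b i) *
        (if ∀ k, 0 < (if k = i then a i / b i else a k - a i / b i * b k) then 1 else 0) =
      (if ∀ k, 0 < a k then 1 else 0) - (if ∀ k, 0 < -b k then 1 else 0) := by
  set P : ι → Prop := fun i => 0 < a i / b i ∧ ∀ k, k ≠ i → 0 < a k - a i / b i * b k with hP
  have hPiff : ∀ i, (∀ k, 0 < (if k = i then a i / b i else a k - a i / b i * b k)) ↔ P i := by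
    intro i
    refine ⟨fun h => ⟨by simpa using h i, fun k hk => by simpa [hk] using h k⟩, ?_⟩
    rintro ⟨h1, h2⟩ k
    split_ifs with hk
    · exact h1
    · exact h2 k hk
  simp only [hPiff]
  set Q : Prop := ∃ t : ℝ, 0 < t ∧ ∀ k, 0 < a k - t * b k with hQ
  -- a small move off the wall `i` lands in the open region
  have hPQ : ∀ i, P i → Q := by
    rintro i ⟨h1, h2⟩
    have hnear : ∀ k, k ≠ i → ∀ᶠ t in nhds (a i / b i), 0 < a k - t * b k := by
      intro k hk
      have hc : Continuous fun t : ℝ => a k - t * b k := by fun_prop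
      exact hc.continuousAt.eventually (lt_mem_nhds (h2 k hk))
    have hall : ∀ᶠ t in nhds (a i / b i), 0 < t ∧ ∀ k, k ≠ i → 0 < a k - t * b k := by
      refine (lt_mem_nhds h1).and ?_
      rw [Filter.eventually_all]
      intro k
      by_cases hk : k = i
      · simp [hk]
      · filter_upwards [hnear k hk] with t ht _ using ht
    have hcancel : a i / b i * b i = a i := div_mul_cancel₀ _ (hb i)
    rcases lt_or_gt_of_ne (hb i) with hneg | hpos
    · obtain ⟨t, ht, ht1, ht2⟩ :=
        ((hall.filter_mono nhdsWithin_le_nhds).and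
          (self_mem_nhdsWithin : Set.Ioi (a i / b i) ∈ nhdsWithin _ _)).exists.imp
          (fun t h => (⟨h.2, h.1.1, h.1.2⟩ : t ∈ Set.Ioi (a i / b i) ∧ _ ∧ _))
      refine ⟨t, ht1, fun k => ?_⟩
      by_cases hk : k = i
      · subst hk
        have : a k / b k < t := ht
        nlinarith
      · exact ht2 k hk
    · obtain ⟨t, ht, ht1, ht2⟩ :=
        ((hall.filter_mono nhdsWithin_le_nhds).and
          (self_mem_nhdsWithin : Set.Iio (a i / b i) ∈ nhdsWithin _ _)).exists.imp
          (fun t h => (⟨h.2, h.1.1, h.1.2⟩ : t ∈ Set.Iio (a i / b i) ∧ _ ∧ _))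
      refine ⟨t, ht1, fun k => ?_⟩
      by_cases hk : k = i
      · subst hk
        have : t < a k / b k := ht
        nlinarith
      · exact ht2 k hk
  have hwall : ∀ i k, k ≠ i → a i / b i ≠ a k / b k := by
    intro i k hk h
    rw [div_eq_div_iff (hb i) (hb k)] at h
    exact hab i k hk.symm h.symm
  have hpos_wall : ∀ i k, 0 < b k → (0 < a k - a i / b i * b k ↔ a i / b i < a k / b k) := by
    intro i k hk
    rw [lt_div_iff₀ hk, sub_pos]
  have hneg_wall : ∀ i k, b k < 0 → (0 < a k - a i / b i * b k ↔ a k / b k < a i / b i) := by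
    intro i k hk
    rw [div_lt_iff_of_neg hk, sub_pos]
  have hposSum : ∑ i, (if 0 < b i ∧ P i then (1 : R) else 0) =
      (if Q then 1 else 0) - (if ∀ k, 0 < -b k then 1 else 0) := by
    by_cases hall : ∀ k, 0 < -b k
    · have hq : Q := by
        have : ∀ k, ∀ᶠ t in Filter.atTop, 0 < a k - t * b k := by
          intro k
          filter_upwards [Filter.eventually_gt_atTop (a k / b k)] with t ht
          have := (div_lt_iff_of_neg (by linarith [hall k] : b k < 0)).1 ht
          linarith
        obtain ⟨t, h1, h2⟩ := ((Filter.eventually_gt_atTop (0 : ℝ)).and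
          (Filter.eventually_all.2 this)).exists
        exact ⟨t, h1, h2⟩
      rw [if_pos hq, if_pos hall, sub_self]
      refine Finset.sum_eq_zero fun i _ => if_neg ?_
      intro h
      linarith [hall i, h.1]
    · rw [if_neg hall, sub_zero]
      by_cases hq : Q
      · rw [if_pos hq]
        apply sum_ite_of_existsUnique
        obtain ⟨t, ht, htk⟩ := hq
        push Not at hall
        obtain ⟨k0, hk0⟩ := hall
        have hk0' : 0 < b k0 := lt_of_le_of_ne (by linarith) (hb k0).symm
        obtain ⟨i, hi, hmin⟩ := Finset.exists_min_image (univ.filter fun i => 0 < b i)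
          (fun i => a i / b i) ⟨k0, by simpa using hk0'⟩
        simp only [mem_filter, mem_univ, true_and] at hi hmin
        have hti : t < a i / b i := by
          rw [lt_div_iff₀ hi]
          linarith [htk i]
        refine ⟨i, ⟨hi, ht.trans hti, fun k hk => ?_⟩, ?_⟩
        · rcases lt_or_gt_of_ne (hb k) with h | h
          · nlinarith [htk k]
          · rw [hpos_wall i k h]
            exact lt_of_le_of_ne (hmin k h) (hwall i k hk)
        · rintro k ⟨hk, -, hk2⟩
          by_contra hne
          have h1 := (hpos_wall k i hi).1 (hk2 i (Ne.symm hne))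
          exact absurd (hmin k hk) (not_le.2 h1)
      · rw [if_neg hq]
        exact Finset.sum_eq_zero fun i _ => if_neg fun h => hq (hPQ i h.2)
  have hnegSum : ∑ i, (if b i < 0 ∧ P i then (1 : R) else 0) =
      (if Q then 1 else 0) - (if ∀ k, 0 < a k then 1 else 0) := by
    by_cases hall : ∀ k, 0 < a k
    · have hq : Q := by
        have : ∀ k, ∀ᶠ t in nhdsWithin (0 : ℝ) (Set.Ioi 0), 0 < a k - t * b k := by
          intro k
          have hc : Continuous fun t : ℝ => a k - t * b k := by fun_prop
          exact (hc.continuousAt.eventually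
            (lt_mem_nhds (by simpa using hall k))).filter_mono nhdsWithin_le_nhds
        obtain ⟨t, h2, h1⟩ := ((Filter.eventually_all.2 this).and
          (self_mem_nhdsWithin : Set.Ioi (0 : ℝ) ∈ nhdsWithin 0 (Set.Ioi 0))).exists
        exact ⟨t, h1, h2⟩
      rw [if_pos hq, if_pos hall, sub_self]
      refine Finset.sum_eq_zero fun i _ => if_neg ?_
      rintro ⟨h1, h2, -⟩
      exact absurd h2 (not_lt.2 (div_nonpos_of_nonneg_of_nonpos (hall i).le h1.le))
    · rw [if_neg hall, sub_zero]
      by_cases hq : Q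
      · rw [if_pos hq]
        apply sum_ite_of_existsUnique
        obtain ⟨t, ht, htk⟩ := hq
        push Not at hall
        obtain ⟨k0, hk0⟩ := hall
        have hak0 : a k0 < 0 := lt_of_le_of_ne hk0 (ha k0)
        have hk0' : b k0 < 0 := by
          by_contra hcon
          have := htk k0
          have : 0 ≤ t * b k0 := mul_nonneg ht.le (not_lt.1 hcon)
          linarith
        obtain ⟨i, hi, hmax⟩ := Finset.exists_max_image (univ.filter fun i => b i < 0)
          (fun i => a i / b i) ⟨k0, by simpa using hk0'⟩
        simp only [mem_filter, mem_univ, true_and] at hi hmax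
        have hti : a i / b i < t := by
          rw [div_lt_iff_of_neg hi]
          linarith [htk i]
        refine ⟨i, ⟨hi, (div_pos_of_neg_of_neg hak0 hk0').trans_le (hmax k0 hk0'),
          fun k hk => ?_⟩, ?_⟩
        · rcases lt_or_gt_of_ne (hb k) with h | h
          · rw [hneg_wall i k h]
            exact lt_of_le_of_ne (hmax k h) (hwall i k hk).symm
          · nlinarith [htk k]
        · rintro k ⟨hk, -, hk2⟩
          by_contra hne
          have h1 := (hneg_wall k i hi).1 (hk2 i (Ne.symm hne))
          exact absurd (hmax k hk) (not_le.2 h1)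
      · rw [if_neg hq]
        exact Finset.sum_eq_zero fun i _ => if_neg fun h => hq (hPQ i h.2)
  have hsplit : ∀ i, signHomTo R (b i) * (if P i then 1 else 0) =
      (if 0 < b i ∧ P i then (1 : R) else 0) - (if b i < 0 ∧ P i then (1 : R) else 0) := by
    intro i
    rcases lt_or_gt_of_ne (hb i) with h | h
    · simp [signHomTo_of_neg h, h, not_lt.2 h.le]
      split_ifs <;> simp
    · simp [signHomTo_of_pos h, h, not_lt.2 h.le]
  rw [Finset.sum_congr rfl fun i _ => hsplit i, Finset.sum_sub_distrib, hposSum, hnegSum]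
  ring

end Exchange

section Coord
variable {ι : Type*} [Fintype ι] [DecidableEq ι]

/-- Coordinates of `p` with respect to the rows of `A`. -/
noncomputable def coord (A : Matrix ι ι ℝ) (p : ι → ℝ) : ι → ℝ := p ᵥ* A⁻¹

lemma coord_vecMul {A : Matrix ι ι ℝ} (hA : A.det ≠ 0) (p : ι → ℝ) : coord A p ᵥ* A = p := by
  rw [coord, vecMul_vecMul, nonsing_inv_mul _ hA.isUnit, vecMul_one]

lemma coord_eq_of_vecMul {A : Matrix ι ι ℝ} (hA : A.det ≠ 0) {c p : ι → ℝ} (h : c ᵥ* A = p) :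
    coord A p = c := by
  rw [coord, ← h, vecMul_vecMul, mul_nonsing_inv _ hA.isUnit, vecMul_one]

lemma sum_coord_smul {A : Matrix ι ι ℝ} (hA : A.det ≠ 0) (p : ι → ℝ) :
    ∑ i, coord A p i • A i = p := by
  rw [← vecMul_eq_sum, coord_vecMul hA]

lemma coord_eq_of_sum {A : Matrix ι ι ℝ} (hA : A.det ≠ 0) {c p : ι → ℝ}
    (h : ∑ i, c i • A i = p) : coord A p = c :=
  coord_eq_of_vecMul hA (by rw [vecMul_eq_sum, h])

lemma coord_neg (A : Matrix ι ι ℝ) (p : ι → ℝ) : coord A (-p) = -coord A p := by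
  rw [coord, coord, neg_vecMul]

lemma det_updateRow_eq {A : Matrix ι ι ℝ} (hA : A.det ≠ 0) (i : ι) (u : ι → ℝ) :
    (A.updateRow i u).det = coord A u i * A.det := by
  conv_lhs => rw [← sum_coord_smul hA u]
  rw [det_updateRow_sum, smul_eq_mul]

lemma coord_updateRow {A : Matrix ι ι ℝ} (hA : A.det ≠ 0) (i : ι) (u p : ι → ℝ)
    (hi : coord A u i ≠ 0) (k : ι) :
    coord (A.updateRow i u) p k =
      if k = i then coord A p i / coord A u i
      else coord A p k - coord A p i / coord A u i * coord A u k := by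
  refine congrFun (coord_eq_of_sum (c := fun k => if k = i then coord A p i / coord A u i
      else coord A p k - coord A p i / coord A u i * coord A u k) ?_ ?_) k
  · rw [det_updateRow_eq hA]
    exact mul_ne_zero hi hA
  set t := coord A p i / coord A u i with ht
  have hti : t * coord A u i = coord A p i := div_mul_cancel₀ _ hi
  have h1 : ∀ k, (if k = i then t else coord A p k - t * coord A u k) • (A.updateRow i u) k =
      (coord A p k • A k - t • (coord A u k • A k)) + (if k = i then t • u else 0) := by
    intro k
    by_cases hk : k = i
    · subst hk
      simp only [if_true, updateRow_self, smul_smul, hti, sub_self, zero_add]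
    · simp only [if_neg hk, updateRow_ne hk, add_zero, sub_smul, smul_smul]
  rw [Finset.sum_congr rfl fun k _ => h1 k, sum_add_distrib, sum_sub_distrib, ← smul_sum,
    sum_coord_smul hA, sum_coord_smul hA]
  simp

/-- Image of the rows of a matrix under a linear map. -/
def mapRows (f : (ι → ℝ) →ₗ[ℝ] (ι → ℝ)) (A : Matrix ι ι ℝ) : Matrix ι ι ℝ := fun i => f (A i)

lemma det_mapRows (f : (ι → ℝ) →ₗ[ℝ] (ι → ℝ)) (A : Matrix ι ι ℝ) :
    (mapRows f A).det = LinearMap.det f * A.det := by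
  have := (Pi.basisFun ℝ ι).det_comp f A
  rwa [Pi.basisFun_det] at this

lemma coord_mapRows {f : (ι → ℝ) →ₗ[ℝ] (ι → ℝ)} (hf : LinearMap.det f ≠ 0)
    {A : Matrix ι ι ℝ} (hA : A.det ≠ 0) (u : ι → ℝ) :
    coord (mapRows f A) (f u) = coord A u := by
  apply coord_eq_of_sum
  · rw [det_mapRows]
    exact mul_ne_zero hf hA
  · conv_rhs => rw [← sum_coord_smul hA u]
    simp [mapRows]

variable (R : Type*) [CommRing R]

open Classical in
/-- The orientation sign of the rows of `A` if `p` is a positive combination of them, else `0`. -/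
noncomputable def coneSign (A : Matrix ι ι ℝ) (p : ι → ℝ) : R :=
  signHomTo R A.det * if ∀ i, 0 < coord A p i then 1 else 0

lemma sum_coneSign_updateRow {A : Matrix ι ι ℝ} (hA : A.det ≠ 0) {p u : ι → ℝ}
    (hp : ∀ i, coord A p i ≠ 0) (hu : ∀ i, coord A u i ≠ 0)
    (hpu : ∀ i k, i ≠ k → coord A p k * coord A u i ≠ coord A p i * coord A u k) :
    ∑ i, coneSign R (A.updateRow i u) p = coneSign R A p - coneSign R A (-u) := by
  classical
  have h := congrArg (signHomTo R A.det * ·) (sum_sign_exchange (R := R) _ _ hp hu hpu)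
  simp only [mul_sum, mul_sub] at h
  simp only [coneSign, coord_neg, Pi.neg_apply]
  rw [← h]
  refine Finset.sum_congr rfl fun i _ => ?_
  simp only [coord_updateRow hA i u p (hu i), det_updateRow_eq hA, map_mul]
  ring

lemma coneSign_mapRows {f : (ι → ℝ) →ₗ[ℝ] (ι → ℝ)} (hf : LinearMap.det f ≠ 0)
    {A : Matrix ι ι ℝ} (hA : A.det ≠ 0) (u : ι → ℝ) :
    coneSign R (mapRows f A) (f u) = signHomTo R (LinearMap.det f) * coneSign R A u := by
  rw [coneSign, coneSign, coord_mapRows hf hA, det_mapRows, map_mul, mul_assoc]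

end Coord

/-- A nonempty open set is not covered by finitely many kernels of nonzero functionals. -/
lemma exists_mem_forall_ne_zero {E : Type*} [NormedAddCommGroup E] [NormedSpace ℝ E]
    [FiniteDimensional ℝ E] {S : Type*} [Finite S] (φ : S → E →ₗ[ℝ] ℝ) (hφ : ∀ s, φ s ≠ 0)
    {U : Set E} (hU : IsOpen U) (hne : U.Nonempty) : ∃ y ∈ U, ∀ s, φ s y ≠ 0 := by
  have hd : Dense (⋂ s, {y | φ s y ≠ 0}) := by
    apply dense_iInter_of_isOpen
    · intro s
      exact isOpen_ne_fun (φ s).continuous_of_finiteDimensional continuous_const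
    · intro s
      have : {y | φ s y ≠ 0} = ((LinearMap.ker (φ s) : Submodule ℝ E) : Set E)ᶜ := by
        ext; simp
      rw [this, ← interior_eq_empty_iff_dense_compl, ← Set.not_nonempty_iff_eq_empty]
      intro h
      exact hφ s (LinearMap.ker_eq_top.1 (Submodule.eq_top_of_nonempty_interior' _ h))
  obtain ⟨y, hy, hy'⟩ := hd.inter_open_nonempty U hU hne
  exact ⟨y, hy, by simpa using hy'⟩

section Rotation
variable {q : ℕ} {J : Type*}

/-- Lift of an element of `ℝ^q`, seen as `ℝ^(q+1)` modulo constants, to `ℝ^(q+1)`. -/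
def liftZero (f : Fin q × J → ℝ) (c : J) : Fin (q + 1) → ℝ := Fin.cons 0 fun i => f (i, c)

@[simp] lemma liftZero_zero (f : Fin q × J → ℝ) (c : J) : liftZero f c 0 = 0 := rfl

@[simp] lemma liftZero_succ (f : Fin q × J → ℝ) (c : J) (i : Fin q) :
    liftZero f c i.succ = f (i, c) := rfl

lemma liftZero_add (f g : Fin q × J → ℝ) (c : J) (j : Fin (q + 1)) :
    liftZero (f + g) c j = liftZero f c j + liftZero g c j := by
  cases j using Fin.cases <;> simp

lemma liftZero_smul (t : ℝ) (f : Fin q × J → ℝ) (c : J) (j : Fin (q + 1)) :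
    liftZero (t • f) c j = t * liftZero f c j := by
  cases j using Fin.cases <;> simp

/-- The cyclic rotation by `k` of the coordinates, on `ℝ^(q+1)` modulo constants. -/
def rot (k : Fin (q + 1)) : (Fin q × J → ℝ) →ₗ[ℝ] (Fin q × J → ℝ) where
  toFun f v := liftZero f v.2 (v.1.succ - k) - liftZero f v.2 (0 - k)
  map_add' f g := by ext v; simp only [liftZero_add, Pi.add_apply]; ring
  map_smul' t f := by
    ext v; simp only [liftZero_smul, Pi.smul_apply, smul_eq_mul, RingHom.id_apply]; ring

lemma rot_apply (k : Fin (q + 1)) (f : Fin q × J → ℝ) (v : Fin q × J) :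
    rot k f v = liftZero f v.2 (v.1.succ - k) - liftZero f v.2 (0 - k) := rfl

lemma liftZero_rot (k : Fin (q + 1)) (f : Fin q × J → ℝ) (c : J) (j : Fin (q + 1)) :
    liftZero (rot k f) c j = liftZero f c (j - k) - liftZero f c (0 - k) := by
  cases j using Fin.cases <;> simp [rot_apply]

lemma rot_rot (k l : Fin (q + 1)) (f : Fin q × J → ℝ) : rot k (rot l f) = rot (k + l) f := by
  ext v
  simp only [rot_apply, liftZero_rot, sub_sub]
  ring

lemma rot_zero : (rot 0 : (Fin q × J → ℝ) →ₗ[ℝ] (Fin q × J → ℝ)) = LinearMap.id := by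
  ext1 f
  ext v
  simp [rot_apply]

lemma rot_pow (k : Fin (q + 1)) (m : ℕ) :
    (rot k : (Fin q × J → ℝ) →ₗ[ℝ] (Fin q × J → ℝ)) ^ m = rot (m • k) := by
  induction m with
  | zero => simp [rot_zero, Module.End.one_eq_id]
  | succ m ih =>
    ext1 f
    rw [pow_succ', ih, succ_nsmul', Module.End.mul_apply, rot_rot]

lemma card_nsmul_fin (k : Fin (q + 1)) : (q + 1) • k = 0 := by
  simpa using card_nsmul_eq_zero (x := k)

lemma det_rot_pow [Fintype J] [DecidableEq J] (k : Fin (q + 1)) :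
    LinearMap.det (rot k : (Fin q × J → ℝ) →ₗ[ℝ] (Fin q × J → ℝ)) ^ (q + 1) = 1 := by
  rw [← map_pow, rot_pow, card_nsmul_fin, rot_zero, LinearMap.det_id]

lemma det_rot_ne_zero [Fintype J] [DecidableEq J] (k : Fin (q + 1)) :
    LinearMap.det (rot k : (Fin q × J → ℝ) →ₗ[ℝ] (Fin q × J → ℝ)) ≠ 0 := by
  intro h
  simpa [h] using det_rot_pow (J := J) k

end Rotation

section Degree
variable {q : ℕ} {J : Type*}

/-- The vectors of the facet `F` of the join of chessboard complexes: `F c i.succ` is the colour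
of the vertex `(i, c)`, and `F c 0` is the colour missing in the class `c`. -/
def facetMat (z : Fin q × J → Fin q × J → ℝ) (F : J → Perm (Fin (q + 1))) :
    Matrix (Fin q × J) (Fin q × J) ℝ := fun v => rot (F v.2 v.1.succ) (z v)

/-- Simultaneous rotation of all colours. -/
def rotFacet (k : Fin (q + 1)) : J → Perm (Fin (q + 1)) := fun _ => Equiv.addLeft k

lemma facetMat_rotFacet (z : Fin q × J → Fin q × J → ℝ) (k : Fin (q + 1))
    (F : J → Perm (Fin (q + 1))) :
    facetMat z (rotFacet k * F) = mapRows (rot k) (facetMat z F) := by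
  ext1 v
  simp [facetMat, mapRows, rotFacet, rot_rot]

section Flip
variable [DecidableEq J]

lemma facetMat_update (z : Fin q × J → Fin q × J → ℝ) (F : J → Perm (Fin (q + 1)))
    (v : Fin q × J) (y : Fin q × J → ℝ) :
    facetMat (Function.update z v y) F =
      (facetMat z F).updateRow v (rot (F v.2 v.1.succ) y) := by
  ext1 u
  by_cases h : u = v
  · subst h
    simp [facetMat]
  · simp [facetMat, h]

/-- The facet adjacent to `F` across the ridge opposite to the vertex `v`. -/
def flip (v : Fin q × J) (F : J → Perm (Fin (q + 1))) : J → Perm (Fin (q + 1)) :=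
  F * Pi.mulSingle v.2 (swap 0 v.1.succ)

lemma flip_flip (v : Fin q × J) (F : J → Perm (Fin (q + 1))) : flip v (flip v F) = F := by
  rw [flip, flip, mul_assoc, ← Pi.mulSingle_mul, Equiv.swap_mul_self, Pi.mulSingle_one, mul_one]

lemma flip_apply_of_ne {v u : Fin q × J} (h : u ≠ v) (F : J → Perm (Fin (q + 1))) :
    flip v F u.2 u.1.succ = F u.2 u.1.succ := by
  by_cases hc : u.2 = v.2
  · have hi : u.1 ≠ v.1 := fun hi => h (Prod.ext hi hc)
    rw [flip, Pi.mul_apply, hc, Pi.mulSingle_eq_same, Perm.mul_apply,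
      swap_apply_of_ne_of_ne (Fin.succ_ne_zero _) (by simpa using hi)]
  · rw [flip, Pi.mul_apply, Pi.mulSingle_eq_of_ne hc, mul_one]

lemma flip_ne (v : Fin q × J) (F : J → Perm (Fin (q + 1))) : flip v F ≠ F := by
  intro h
  have h1 := congrFun (mul_eq_left.1 h) v.2
  rw [Pi.mulSingle_eq_same, Pi.one_apply, swap_eq_one_iff] at h1
  exact Fin.succ_ne_zero _ h1.symm

lemma updateRow_facetMat_flip (z : Fin q × J → Fin q × J → ℝ) (v : Fin q × J)
    (F : J → Perm (Fin (q + 1))) (u : Fin q × J → ℝ) :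
    (facetMat z (flip v F)).updateRow v u = (facetMat z F).updateRow v u := by
  ext w j
  by_cases h : w = v
  · subst h
    simp
  · rw [updateRow_ne h, updateRow_ne h]
    simp only [facetMat, flip_apply_of_ne h]

end Flip

section Sign
variable (R : Type*) [CommRing R] [Fintype J]

/-- Orientation sign of a facet. -/
def facetSign : (J → Perm (Fin (q + 1))) →* R where
  toFun F := ∏ c, ((Perm.sign (F c) : ℤ) : R)
  map_one' := by simp
  map_mul' F G := by simp [Finset.prod_mul_distrib]

lemma facetSign_apply (F : J → Perm (Fin (q + 1))) :
    facetSign R F = ∏ c, ((Perm.sign (F c) : ℤ) : R) := rfl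

lemma facetSign_rotFacet_pow (k : Fin (q + 1)) :
    facetSign R (rotFacet k : J → Perm (Fin (q + 1))) ^ (q + 1) = 1 := by
  rw [← map_pow]
  have : (rotFacet k : J → Perm (Fin (q + 1))) ^ (q + 1) = 1 := by
    funext c
    rw [Pi.pow_apply, rotFacet, Equiv.nsmul_addLeft, card_nsmul_fin, Equiv.addLeft_zero]
    rfl
  rw [this, map_one]

end Sign

variable [Fintype J] [DecidableEq J] (R : Type*) [CommRing R]

/-- The signed number of facets whose cone contains `p`. -/
noncomputable def degree (z : Fin q × J → Fin q × J → ℝ) (p : Fin q × J → ℝ) : R :=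
  ∑ F : J → Perm (Fin (q + 1)), facetSign R F * coneSign R (facetMat z F) p

lemma facetSign_flip (v : Fin q × J) (F : J → Perm (Fin (q + 1))) :
    facetSign R (flip v F) = -facetSign R F := by
  have h : facetSign R (Pi.mulSingle v.2 (swap 0 v.1.succ) : J → Perm (Fin (q + 1))) = -1 := by
    rw [facetSign_apply, Finset.prod_eq_single v.2]
    · rw [Pi.mulSingle_eq_same, Perm.sign_swap (Fin.succ_ne_zero _).symm]
      simp
    · intro c _ hc
      simp [Pi.mulSingle_eq_of_ne hc]
    · simp
  rw [flip, map_mul, h, mul_neg_one]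

lemma sum_flip_cancel (z : Fin q × J → Fin q × J → ℝ) (p y : Fin q × J → ℝ) {v i : Fin q × J}
    (hi : i ≠ v) :
    ∑ F : J → Perm (Fin (q + 1)), facetSign R F *
      coneSign R ((facetMat z F).updateRow i (rot (F v.2 v.1.succ) y)) p = 0 := by
  refine Finset.sum_involution (fun F _ => flip i F) ?_ (fun F _ _ => flip_ne i F)
    (fun _ _ => mem_univ _) (fun F _ => flip_flip i F)
  intro F _
  rw [facetSign_flip, flip_apply_of_ne hi.symm, updateRow_facetMat_flip]
  ring

/-- A sum over facets of a rotation invariant function is divisible by `q + 1`. -/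
lemma sum_eq_zero_of_rot_invariant [CharP R (q + 1)] (h : (J → Perm (Fin (q + 1))) → R)
    (hh : ∀ k F, h (rotFacet k * F) = h F) (v : Fin q × J) : ∑ F, h F = 0 := by
  have h1 : ∀ F : J → Perm (Fin (q + 1)),
      h F = ∑ k, if F v.2 v.1.succ = k then h F else 0 := by
    intro F
    simp
  have h2 : ∀ k, ∑ F : J → Perm (Fin (q + 1)), (if F v.2 v.1.succ = k then h F else 0) =
      ∑ F : J → Perm (Fin (q + 1)), (if F v.2 v.1.succ = 0 then h F else 0) := by
    intro k
    rw [← Equiv.sum_comp (Equiv.mulLeft (rotFacet k : J → Perm (Fin (q + 1))))]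
    refine Finset.sum_congr rfl fun F _ => ?_
    simp [hh, rotFacet]
  rw [Finset.sum_congr rfl fun F _ => h1 F, Finset.sum_comm, Finset.sum_congr rfl fun k _ => h2 k,
    Finset.sum_const, card_univ, Fintype.card_fin, nsmul_eq_mul, CharP.cast_eq_zero, zero_mul]

/-- All facets are bases, and `p` is on no hyperplane spanned by a ridge. -/
def Generic (z : Fin q × J → Fin q × J → ℝ) (p : Fin q × J → ℝ) : Prop :=
  ∀ F : J → Perm (Fin (q + 1)), (facetMat z F).det ≠ 0 ∧ ∀ i, coord (facetMat z F) p i ≠ 0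

/-- `y` may replace the vector of the vertex `v`. -/
def Admissible (z : Fin q × J → Fin q × J → ℝ) (p : Fin q × J → ℝ) (v : Fin q × J)
    (y : Fin q × J → ℝ) : Prop :=
  ∀ F : J → Perm (Fin (q + 1)),
    (∀ i, coord (facetMat z F) (rot (F v.2 v.1.succ) y) i ≠ 0) ∧
    ∀ i k, i ≠ k → coord (facetMat z F) p k * coord (facetMat z F) (rot (F v.2 v.1.succ) y) i ≠
      coord (facetMat z F) p i * coord (facetMat z F) (rot (F v.2 v.1.succ) y) k

lemma Generic.update {z : Fin q × J → Fin q × J → ℝ} {p : Fin q × J → ℝ} (hz : Generic z p)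
    {v : Fin q × J} {y : Fin q × J → ℝ} (hy : Admissible z p v y) :
    Generic (Function.update z v y) p := by
  intro F
  obtain ⟨h1, h2⟩ := hz F
  obtain ⟨h3, h4⟩ := hy F
  rw [facetMat_update]
  refine ⟨?_, fun i => ?_⟩
  · rw [det_updateRow_eq h1]
    exact mul_ne_zero (h3 v) h1
  · rw [coord_updateRow h1 _ _ _ (h3 v)]
    split_ifs with hi
    · exact div_ne_zero (h2 v) (h3 v)
    · intro h
      apply h4 v i (Ne.symm hi)
      rw [sub_eq_zero, div_mul_eq_mul_div, eq_div_iff (h3 v)] at h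
      exact h

lemma degree_update [Fact (q + 1).Prime] {z : Fin q × J → Fin q × J → ℝ}
    {p : Fin q × J → ℝ} (hz : Generic z p) {v : Fin q × J} {y : Fin q × J → ℝ}
    (hy : Admissible z p v y) :
    degree (ZMod (q + 1)) (Function.update z v y) p = degree (ZMod (q + 1)) z p := by
  have h1 : ∀ F : J → Perm (Fin (q + 1)),
      ∑ i, coneSign (ZMod (q + 1)) ((facetMat z F).updateRow i (rot (F v.2 v.1.succ) y)) p =
        coneSign (ZMod (q + 1)) (facetMat z F) p -
          coneSign (ZMod (q + 1)) (facetMat z F) (-rot (F v.2 v.1.succ) y) := fun F =>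
    sum_coneSign_updateRow _ (hz F).1 (hz F).2 (hy F).1 (hy F).2
  have h2 : ∑ F : J → Perm (Fin (q + 1)), facetSign (ZMod (q + 1)) F *
      coneSign (ZMod (q + 1)) (facetMat z F) (-rot (F v.2 v.1.succ) y) = 0 := by
    refine sum_eq_zero_of_rot_invariant _ _ (fun k F => ?_) v
    have hone : facetSign (ZMod (q + 1)) (rotFacet k : J → Perm (Fin (q + 1))) *
        signHomTo (ZMod (q + 1)) (LinearMap.det
          (rot k : (Fin q × J → ℝ) →ₗ[ℝ] (Fin q × J → ℝ))) = 1 := by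
      rw [← ZMod.pow_card (_ * _), mul_pow, facetSign_rotFacet_pow, ← map_pow, det_rot_pow,
        map_one, one_mul]
    have hrot : -rot ((rotFacet k * F : J → Perm (Fin (q + 1))) v.2 v.1.succ) y = rot k (-rot (F v.2 v.1.succ) y) := by
      rw [map_neg, rot_rot]
      rfl
    rw [hrot, facetMat_rotFacet, coneSign_mapRows _ (det_rot_ne_zero k) (hz F).1, map_mul]
    linear_combination (facetSign (ZMod (q + 1)) F *
      coneSign (ZMod (q + 1)) (facetMat z F) (-rot (F v.2 v.1.succ) y)) * hone
  have h3 : degree (ZMod (q + 1)) (Function.update z v y) p =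
      ∑ F : J → Perm (Fin (q + 1)), facetSign (ZMod (q + 1)) F *
        ∑ i, coneSign (ZMod (q + 1))
          ((facetMat z F).updateRow i (rot (F v.2 v.1.succ) y)) p := by
    simp only [mul_sum]
    rw [Finset.sum_comm, Finset.sum_eq_single v]
    · simp only [degree, facetMat_update]
    · intro i _ hi
      exact sum_flip_cancel _ z p y hi
    · simp
  rw [h3]
  simp only [h1, mul_sub, sum_sub_distrib, h2, sub_zero]
  rfl

lemma exists_admissible {z : Fin q × J → Fin q × J → ℝ} {p : Fin q × J → ℝ} (hz : Generic z p)
    (v : Fin q × J) {U : Set (Fin q × J → ℝ)} (hU : IsOpen U) (hne : U.Nonempty) :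
    ∃ y ∈ U, Admissible z p v y := by
  -- the coordinate functionals of the facets
  let κ : (J → Perm (Fin (q + 1))) → (Fin q × J → ℝ) →ₗ[ℝ] (Fin q × J → ℝ) := fun F =>
    (facetMat z F)⁻¹.vecMulLinear ∘ₗ rot (F v.2 v.1.succ)
  have hκ : ∀ F y, κ F y = coord (facetMat z F) (rot (F v.2 v.1.succ) y) := fun F y => rfl
  have hsurj : ∀ F w, ∃ y, κ F y = w := by
    intro F w
    refine ⟨rot (-(F v.2 v.1.succ)) (w ᵥ* facetMat z F), ?_⟩
    rw [hκ, rot_rot, add_neg_cancel, rot_zero]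
    exact coord_eq_of_vecMul (hz F).1 rfl
  let S := (J → Perm (Fin (q + 1))) × ((Fin q × J) ⊕ {x : (Fin q × J) × (Fin q × J) // x.1 ≠ x.2})
  let φ : S → (Fin q × J → ℝ) →ₗ[ℝ] ℝ := fun s => match s with
    | (F, .inl i) => LinearMap.proj i ∘ₗ κ F
    | (F, .inr x) => coord (facetMat z F) p x.1.2 • (LinearMap.proj x.1.1 ∘ₗ κ F) -
        coord (facetMat z F) p x.1.1 • (LinearMap.proj x.1.2 ∘ₗ κ F)
  have hφ : ∀ s, φ s ≠ 0 := by
    rintro ⟨F, i | ⟨⟨i, k⟩, hik⟩⟩ h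
    · obtain ⟨y, hy⟩ := hsurj F (Pi.single i 1)
      have := LinearMap.congr_fun h y
      simp [φ, hy] at this
    · obtain ⟨y, hy⟩ := hsurj F (Pi.single i 1)
      have := LinearMap.congr_fun h y
      have hik' : k ≠ i := Ne.symm hik
      simp [φ, hy, hik', (hz F).2 k] at this
  obtain ⟨y, hyU, hy⟩ := exists_mem_forall_ne_zero φ hφ hU hne
  refine ⟨y, hyU, fun F => ⟨fun i => hy (F, .inl i), fun i k hik h => ?_⟩⟩
  apply hy (F, .inr ⟨(i, k), hik⟩)
  simp only [φ, LinearMap.sub_apply, LinearMap.smul_apply, LinearMap.comp_apply,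
    LinearMap.proj_apply, hκ, smul_eq_mul]
  exact sub_eq_zero.2 h

lemma exists_generic_degree_eq [Fact (q + 1).Prime] {z : Fin q × J → Fin q × J → ℝ}
    {p : Fin q × J → ℝ} (hz : Generic z p) (U : Fin q × J → Set (Fin q × J → ℝ))
    (hU : ∀ v, IsOpen (U v)) (hne : ∀ v, (U v).Nonempty) :
    ∃ z', (∀ v, z' v ∈ U v) ∧ Generic z' p ∧
      degree (ZMod (q + 1)) z' p = degree (ZMod (q + 1)) z p := by
  suffices h : ∀ S : Finset (Fin q × J), ∃ z', (∀ v ∈ S, z' v ∈ U v) ∧ Generic z' p ∧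
      degree (ZMod (q + 1)) z' p = degree (ZMod (q + 1)) z p by
    obtain ⟨z', h1, h2⟩ := h univ
    exact ⟨z', fun v => h1 v (mem_univ v), h2⟩
  intro S
  induction S using Finset.induction_on with
  | empty => exact ⟨z, by simp, hz, rfl⟩
  | insert v S hv ih =>
    obtain ⟨z', h1, h2, h3⟩ := ih
    obtain ⟨y, hy, hadm⟩ := exists_admissible h2 v (hU v) (hne v)
    refine ⟨Function.update z' v y, ?_, h2.update hadm, (degree_update h2 hadm).trans h3⟩
    intro u hu
    by_cases huv : u = v
    · subst huv
      simpa using hy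
    · rw [Function.update_of_ne huv]
      exact h1 u (mem_of_mem_insert_of_ne hu huv)

end Degree

section Simplex
variable {q : ℕ}

/-- The vertices of a simplex in `ℝ^q` with barycenter `0`. -/
def simplexVertex (k : Fin (q + 1)) (i : Fin q) : ℝ :=
  (if i.succ = k then 1 else 0) - if 0 = k then 1 else 0

lemma sum_simplexVertex_mul (g : Fin (q + 1) → ℝ) (i : Fin q) :
    ∑ k, g k * simplexVertex k i = g i.succ - g 0 := by
  simp [simplexVertex, mul_sub, sum_sub_distrib]

/-- The tensor product of `x` with `simplexVertex 0`. -/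
def tensorZero {J : Type*} (x : J → ℝ) : Fin q × J → ℝ := fun u => -x u.2

lemma rot_tensorZero {J : Type*} (k : Fin (q + 1)) (x : J → ℝ) (u : Fin q × J) :
    rot k (tensorZero x) u = x u.2 * simplexVertex k u.1 := by
  have h : ∀ c (j : Fin (q + 1)), liftZero (tensorZero x) c j =
      x c * ((if j = 0 then 1 else 0) - 1) := by
    intro c j
    cases j using Fin.cases <;> simp [tensorZero]
  rw [rot_apply, h, h]
  simp only [simplexVertex, sub_eq_zero]
  ring

lemma det_simplexVertex_perm (π : Perm (Fin (q + 1))) :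
    (of fun i i' : Fin q => simplexVertex (π i.succ) i').det = (Perm.sign π : ℤ) := by
  let B : Perm (Fin (q + 1)) → Matrix (Fin (q + 1)) (Fin (q + 1)) ℝ := fun π =>
    of fun j => Fin.cons 1 (simplexVertex (π j))
  have hrow : ∀ π, ∑ k, (1 : ℝ) • B π k = Fin.cons ((q : ℝ) + 1) 0 := by
    intro π
    ext j
    refine (Finset.sum_apply j _ _).trans ?_
    refine Fin.cases ?_ (fun i => ?_) j
    · simp [B]
    · have h := sum_simplexVertex_mul (fun _ => (1 : ℝ)) i
      rw [← Equiv.sum_comp π] at h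
      simpa [B] using h
  have hB : ∀ π, (B π).det =
      ((q : ℝ) + 1) * (of fun i i' : Fin q => simplexVertex (π i.succ) i').det := by
    intro π
    have h := det_updateRow_sum (B π) 0 (fun _ => (1 : ℝ))
    rw [hrow, one_smul] at h
    rw [← h, det_succ_row_zero, Fin.sum_univ_succ]
    simp only [updateRow_self, Fin.cons_zero, Fin.cons_succ]
    simp
    left
    rfl
  have hone : (of fun i i' : Fin q => simplexVertex ((1 : Perm (Fin (q + 1))) i.succ) i') = 1 := by
    ext i i'
    simp [simplexVertex, one_apply, eq_comm]
  have hperm : (B π).det = (Perm.sign π : ℤ) * (B 1).det := by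
    rw [← det_permute]
    rfl
  rw [hB, hB, hone, det_one] at hperm
  have hq : (q : ℝ) + 1 ≠ 0 := by positivity
  apply mul_left_cancel₀ hq
  rw [hperm]
  ring

end Simplex

section Start

lemma facetSign_mul_self {q : ℕ} {J : Type*} [Fintype J] (R : Type*) [CommRing R] (F : J → Perm (Fin (q + 1))) :
    facetSign R F * facetSign R F = 1 := by
  rw [facetSign_apply, ← prod_mul_distrib]
  refine prod_eq_one fun c _ => ?_
  rw [← Int.cast_mul, ← Units.val_mul, Int.units_mul_self]
  simp

variable {q : ℕ} {J : Type*} [DecidableEq J]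

/-- The configuration in which every colour class is concentrated at a basis vector. -/
def startConfig (v : Fin q × J) : Fin q × J → ℝ := tensorZero (Pi.single v.2 1)

lemma rot_startConfig (k : Fin (q + 1)) (v u : Fin q × J) :
    rot k (startConfig v) u = if u.2 = v.2 then simplexVertex k u.1 else 0 := by
  rw [startConfig, rot_tensorZero]
  simp [Pi.single_apply]

lemma facetMat_startConfig (F : J → Perm (Fin (q + 1))) :
    facetMat startConfig F =
      blockDiagonal fun c => of fun i i' : Fin q => simplexVertex (F c i.succ) i' := by
  ext v u
  rw [facetMat, rot_startConfig, blockDiagonal_apply]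
  simp [eq_comm]

variable [Fintype J]

lemma det_facetMat_startConfig (F : J → Perm (Fin (q + 1))) :
    (facetMat startConfig F).det = facetSign ℝ F := by
  rw [facetMat_startConfig, det_blockDiagonal, facetSign_apply]
  simp only [det_simplexVertex_perm]

lemma det_facetMat_startConfig_ne_zero (F : J → Perm (Fin (q + 1))) :
    (facetMat startConfig F).det ≠ 0 := by
  rw [det_facetMat_startConfig]
  exact left_ne_zero_of_mul_eq_one (facetSign_mul_self ℝ F)

lemma coord_facetMat_startConfig (F : J → Perm (Fin (q + 1))) (p : Fin q × J → ℝ) (i : Fin q)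
    (c : J) : coord (facetMat startConfig F) p (i, c) =
      liftZero p c (F c i.succ) - liftZero p c (F c 0) := by
  refine congrFun (coord_eq_of_sum (c := fun v => liftZero p v.2 (F v.2 v.1.succ) -
    liftZero p v.2 (F v.2 0)) (det_facetMat_startConfig_ne_zero F) ?_) (i, c)
  ext ⟨i', c'⟩
  rw [Finset.sum_apply, Fintype.sum_prod_type, Finset.sum_comm, Finset.sum_eq_single c']
  · have h := sum_simplexVertex_mul (fun k => liftZero p c' k - liftZero p c' (F c' 0)) i'
    rw [← Equiv.sum_comp (F c'), Fin.sum_univ_succ] at h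
    simpa [facetMat, rot_startConfig] using h
  · intro c'' _ hc
    simp [facetMat, rot_startConfig, hc.symm]
  · simp

lemma exists_generic_startConfig {U : Set (Fin q × J → ℝ)} (hU : IsOpen U) (hne : U.Nonempty) :
    ∃ p ∈ U, Generic startConfig p ∧ ∀ c, Function.Injective (liftZero p c) := by
  let S := J × {x : Fin (q + 1) × Fin (q + 1) // x.1 ≠ x.2}
  let ev : J → Fin (q + 1) → (Fin q × J → ℝ) →ₗ[ℝ] ℝ := fun c j =>
    { toFun := fun p => liftZero p c j
      map_add' := fun f g => liftZero_add f g c j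
      map_smul' := fun t f => liftZero_smul t f c j }
  let φ : S → (Fin q × J → ℝ) →ₗ[ℝ] ℝ := fun s => ev s.1 s.2.1.1 - ev s.1 s.2.1.2
  have hφ : ∀ s, φ s ≠ 0 := by
    rintro ⟨c, ⟨j, k⟩, hjk⟩ h
    have h1 : ∀ l, liftZero (fun v : Fin q × J => simplexVertex j v.1) c l =
        (if l = j then 1 else 0) - if 0 = j then 1 else 0 := by
      intro l
      cases l using Fin.cases <;> simp [simplexVertex]
    have h2 := LinearMap.congr_fun h (fun v => simplexVertex j v.1)
    have hkj : k ≠ j := Ne.symm hjk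
    simp [φ, ev, h1, hkj] at h2
  obtain ⟨p, hpU, hp⟩ := exists_mem_forall_ne_zero φ hφ hU hne
  have hinj : ∀ c, Function.Injective (liftZero p c) := by
    intro c j k h
    by_contra hjk
    exact hp (c, ⟨(j, k), hjk⟩) (sub_eq_zero.2 h)
  refine ⟨p, hpU, fun F => ⟨det_facetMat_startConfig_ne_zero F, ?_⟩, hinj⟩
  rintro ⟨i, c⟩ h
  rw [coord_facetMat_startConfig F p, sub_eq_zero] at h
  exact Fin.succ_ne_zero i ((F c).injective (hinj c h))

lemma sum_perm_apply_zero (R : Type*) [CommRing R] (m : Fin (q + 1)) :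
    ∑ π : Perm (Fin (q + 1)), (if π 0 = m then (1 : R) else 0) = (q.factorial : R) := by
  rw [← Equiv.sum_comp Perm.decomposeFin.symm, Fintype.sum_prod_type]
  simp [Perm.decomposeFin_symm_apply_zero, Fintype.card_perm]

lemma degree_startConfig [Fact (q + 1).Prime] {p : Fin q × J → ℝ}
    (hp : ∀ c, Function.Injective (liftZero p c)) :
    degree (ZMod (q + 1)) startConfig p ≠ 0 := by
  classical
  choose m hm using fun c => Finset.exists_min_image univ (liftZero p c) univ_nonempty
  have hterm : ∀ F : J → Perm (Fin (q + 1)),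
      facetSign (ZMod (q + 1)) F * coneSign (ZMod (q + 1)) (facetMat startConfig F) p =
        ∏ c, if F c 0 = m c then 1 else 0 := by
    intro F
    have hsign : signHomTo (ZMod (q + 1)) (facetSign ℝ F) = facetSign (ZMod (q + 1)) F := by
      simp only [facetSign_apply, map_prod, signHomTo_intUnits]
    have hiff : (∀ v, 0 < coord (facetMat startConfig F) p v) ↔ ∀ c, F c 0 = m c := by
      constructor
      · intro h c
        by_contra hne
        obtain ⟨i, hi⟩ : ∃ i : Fin q, i.succ = (F c).symm (m c) := by
          rw [Fin.exists_succ_eq]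
          intro h0
          rw [Equiv.symm_apply_eq] at h0
          exact hne h0.symm
        have h1 := h (i, c)
        rw [coord_facetMat_startConfig F p, hi, Equiv.apply_symm_apply] at h1
        linarith [(hm c).2 (F c 0) (mem_univ _)]
      · rintro h ⟨i, c⟩
        rw [coord_facetMat_startConfig F p, h c, sub_pos]
        refine lt_of_le_of_ne ((hm c).2 _ (mem_univ _)) fun heq => ?_
        have := hp c heq
        rw [← h c] at this
        exact Fin.succ_ne_zero i ((F c).injective this).symm
    rw [coneSign, det_facetMat_startConfig, hsign, ← mul_assoc, facetSign_mul_self, one_mul]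
    simp only [hiff]
    by_cases hall : ∀ c, F c 0 = m c
    · simp [hall]
    · rw [if_neg hall]
      push Not at hall
      obtain ⟨c, hc⟩ := hall
      exact (Finset.prod_eq_zero (mem_univ c) (if_neg hc)).symm
  rw [degree, Finset.sum_congr rfl fun F _ => hterm F,
    ← Fintype.prod_sum fun c (π : Perm (Fin (q + 1))) => if π 0 = m c then (1 : ZMod (q + 1)) else 0,
    Finset.prod_ne_zero_iff]
  intro c _
  rw [sum_perm_apply_zero, Ne, ZMod.natCast_eq_zero_iff,
    (Fact.out : (q + 1).Prime).dvd_factorial]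
  omega

end Start

/-- The alternative of Gordan. -/
lemma exists_pos_functional {E κ : Type*} [NormedAddCommGroup E] [NormedSpace ℝ E] [Fintype κ]
    (w : κ → E) (h : ∀ c : κ → ℝ, (∀ k, 0 ≤ c k) → ∑ k, c k • w k = 0 → c = 0) :
    ∃ f : E →L[ℝ] ℝ, ∀ k, 0 < f (w k) := by
  classical
  let L : (κ → ℝ) →ₗ[ℝ] E := Fintype.linearCombination ℝ w
  have hL : ∀ c, L c = ∑ k, c k • w k := fun c => Fintype.linearCombination_apply ℝ w c
  have hcont : Continuous L := L.continuous_of_finiteDimensional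
  have h0 : (0 : E) ∉ L '' stdSimplex ℝ κ := by
    rintro ⟨c, ⟨hc, hsum⟩, hc0⟩
    rw [h c hc (by rw [← hL, hc0])] at hsum
    simp at hsum
  obtain ⟨f, u, hu, hf⟩ := geometric_hahn_banach_point_closed
    ((convex_stdSimplex ℝ κ).linear_image L) ((isCompact_stdSimplex ℝ κ).image hcont).isClosed h0
  refine ⟨f, fun k => ?_⟩
  have h1 := hf (w k) ⟨Pi.single k 1, single_mem_stdSimplex ℝ k, by
    rw [hL]; simp [Pi.single_apply]⟩
  rw [map_zero] at hu
  linarith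

section Main
variable {q : ℕ} {J : Type*} [Fintype J] [DecidableEq J]

theorem exists_facet_combination [Fact (q + 1).Prime] (y : Fin q × J → Fin q × J → ℝ)
    (y₀ : Fin q × J → ℝ) :
    ∃ (F : J → Perm (Fin (q + 1))) (c : Option (Fin q × J) → ℝ),
      (∀ o, 0 ≤ c o) ∧ c ≠ 0 ∧
        c none • y₀ + ∑ v, c (some v) • rot (F v.2 v.1.succ) (y v) = 0 := by
  by_contra! hcon
  have hsep : ∀ F : J → Perm (Fin (q + 1)), ∃ f : (Fin q × J → ℝ) →L[ℝ] ℝ,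
      0 < f y₀ ∧ ∀ v, 0 < f (rot (F v.2 v.1.succ) (y v)) := by
    intro F
    obtain ⟨f, hf⟩ := exists_pos_functional
      (fun o : Option (Fin q × J) => o.elim y₀ fun v => rot (F v.2 v.1.succ) (y v)) (by
        intro c hc hsum
        by_contra hne
        rw [Fintype.sum_option] at hsum
        exact hcon F c hc hne hsum)
    exact ⟨f, hf none, fun v => hf (some v)⟩
  choose f hf₀ hf using hsep
  let U₀ : Set (Fin q × J → ℝ) := ⋂ F, {p | f F p < 0}
  let U : Fin q × J → Set (Fin q × J → ℝ) := fun v =>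
    ⋂ F, {x | 0 < f F (rot (F v.2 v.1.succ) x)}
  have hU₀ : IsOpen U₀ :=
    isOpen_iInter_of_finite fun F => isOpen_lt (f F).continuous continuous_const
  have hU : ∀ v, IsOpen (U v) := fun v => isOpen_iInter_of_finite fun F =>
    isOpen_lt continuous_const
      ((f F).continuous.comp (rot (F v.2 v.1.succ)).continuous_of_finiteDimensional)
  obtain ⟨p, hpU, hgen, hinj⟩ := exists_generic_startConfig hU₀
    ⟨-y₀, Set.mem_iInter.2 fun F => by simpa using hf₀ F⟩
  obtain ⟨z, hzU, hz, hdeg⟩ := exists_generic_degree_eq hgen U hU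
    fun v => ⟨y v, Set.mem_iInter.2 fun F => hf F v⟩
  apply degree_startConfig hinj
  rw [← hdeg]
  refine Finset.sum_eq_zero fun F _ => ?_
  rw [coneSign, if_neg, mul_zero, mul_zero]
  intro hpos
  have h1 : f F p < 0 := Set.mem_iInter.1 hpU F
  rw [← sum_coord_smul (hz F).1 p, map_sum] at h1
  refine absurd h1 (not_lt.2 (Finset.sum_nonneg fun v _ => ?_))
  rw [map_smul, smul_eq_mul]
  exact mul_nonneg (hpos v).le (Set.mem_iInter.1 (hzU v) F).le

end Main

section Tensor
variable {q : ℕ} {J : Type*}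

/-- The colour of a vertex of the join of chessboard complexes with an additional vertex. -/
def vertexColor (F : J → Perm (Fin (q + 1))) (o : Option (Fin q × J)) : Fin (q + 1) :=
  o.elim 0 fun v => F v.2 v.1.succ

lemma vertexColor_some (F : J → Perm (Fin (q + 1))) (v : Fin q × J) :
    vertexColor F (some v) = F v.2 v.1.succ := rfl

theorem exists_facet_equal_sums [Fact (q + 1).Prime] [Fintype J] [DecidableEq J]
    (X : Option (Fin q × J) → J → ℝ) :
    ∃ (F : J → Perm (Fin (q + 1))) (c : Option (Fin q × J) → ℝ),
      (∀ o, 0 ≤ c o) ∧ c ≠ 0 ∧ ∀ κ j,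
        ∑ o, (if vertexColor F o = j then c o * X o κ else 0) =
          ∑ o, if vertexColor F o = 0 then c o * X o κ else 0 := by
  obtain ⟨F, c, hc, hne, hsum⟩ :=
    exists_facet_combination (fun v : Fin q × J => tensorZero (X (some v))) (tensorZero (X none))
  refine ⟨F, c, hc, hne, fun κ j => ?_⟩
  refine Fin.cases rfl (fun i => ?_) j
  have h1 : ∑ o, c o • rot (vertexColor F o) (tensorZero (X o)) = 0 := by
    rw [Fintype.sum_option, ← hsum]
    simp [vertexColor, rot_zero]
  have h2 : ∑ o, c o * (X o κ * simplexVertex (vertexColor F o) i) = 0 := by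
    have := congrFun h1 (i, κ)
    simpa [rot_tensorZero] using this
  refine sub_eq_zero.1 (Eq.trans ?_ h2)
  rw [← sum_sub_distrib]
  refine Finset.sum_congr rfl fun o _ => ?_
  simp only [simplexVertex, mul_sub, mul_ite, mul_one, mul_zero,
    @eq_comm _ _ (vertexColor F o)]

end Tensor

/-- The linear form of the optimal colored Tverberg theorem. -/
theorem exists_rainbow_equal_sums {q : ℕ} [Fact (q + 1).Prime] {V K C : Type*} [Fintype V]
    [Fintype K] [Fintype C] [DecidableEq C] (hcard : Fintype.card V = q * Fintype.card K + 1)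
    (x : V → K → ℝ) (col : V → C)
    (hcol : ∀ c, (univ.filter fun v => col v = c).card ≤ q) :
    ∃ (g : V → Fin (q + 1)) (w : V → ℝ), (∀ v, 0 ≤ w v) ∧ w ≠ 0 ∧
      (∀ u v, col u = col v → g u = g v → u = v) ∧
      ∀ k j, ∑ v, (if g v = j then w v * x v k else 0) =
        ∑ v, if g v = 0 then w v * x v k else 0 := by
  classical
  have hVC : Fintype.card V ≤ q * Fintype.card C := by
    have h := Finset.card_le_mul_card_image_of_maps_to (s := (univ : Finset V)) (t := univ)
      (f := col) (fun _ _ => mem_univ _) q (fun c _ => hcol c)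
    simpa using h
  have hKC : Fintype.card K ≤ Fintype.card C := by
    by_contra hlt
    have := Nat.mul_le_mul_left q (not_le.1 hlt).le
    omega
  obtain ⟨κ₀⟩ := Function.Embedding.nonempty_of_card_le hKC
  -- place the vertices of each class in distinct rows
  have hidx : ∀ c, ∃ f : {v // col v = c} → Fin q, Function.Injective f := by
    intro c
    have : Fintype.card {v // col v = c} ≤ Fintype.card (Fin q) := by
      rw [Fintype.card_fin, Fintype.card_subtype]
      exact hcol c
    obtain ⟨f⟩ := Function.Embedding.nonempty_of_card_le this
    exact ⟨f, f.injective⟩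
  choose idx hidx using hidx
  let e : V → Fin q × C := fun v => (idx (col v) ⟨v, rfl⟩, col v)
  have he : Function.Injective e := by
    intro u v h
    obtain ⟨h1, h2⟩ := Prod.ext_iff.1 h
    have key : ∀ c (hu : col u = c) (hv : col v = c), idx c ⟨u, hu⟩ = idx c ⟨v, hv⟩ → u = v :=
      fun c hu hv h => congrArg Subtype.val (hidx c h)
    apply key (col v) h2 rfl
    have : ∀ c (hu : col u = c), idx (col u) ⟨u, rfl⟩ = idx c ⟨u, hu⟩ := by
      rintro _ rfl; rfl
    rw [← this]
    exact h1
  let ι : V → Option (Fin q × C) := fun v => some (e v)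
  have hι : Function.Injective ι := (Option.some_injective _).comp he
  -- the remaining vertices are distributed over the remaining coordinates
  let Dummy := {o // o ∉ Set.range ι}
  let T := {c // c ∉ Set.range κ₀}
  have hDummy : Fintype.card Dummy = Fintype.card (Fin q × T) := by
    have h1 : Fintype.card Dummy = (q * Fintype.card C + 1) - Fintype.card V := by
      rw [Fintype.card_subtype_compl, Fintype.card_option, Fintype.card_prod, Fintype.card_fin]
      congr 1
      exact Set.card_range_of_injective hι
    have h2 : Fintype.card T = Fintype.card C - Fintype.card K := by
      rw [Fintype.card_subtype_compl]
      congr 1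
      exact Set.card_range_of_injective κ₀.injective
    rw [h1, Fintype.card_prod, Fintype.card_fin, h2, Nat.mul_sub, hcard]
    omega
  let θ : Dummy ≃ Fin q × T := Fintype.equivOfCardEq hDummy
  let Φ : V ⊕ Dummy ≃ Option (Fin q × C) :=
    ((Equiv.ofInjective ι hι).sumCongr (Equiv.refl _)).trans (Equiv.Set.sumCompl (Set.range ι))
  have hΦl : ∀ v, Φ (.inl v) = some (e v) := fun v => rfl
  obtain ⟨F, c, hc, hne, hsum⟩ := exists_facet_equal_sums (q := q) (J := C) fun o =>
    Sum.elim (fun v => Function.extend κ₀ (x v) 0) (fun o => Pi.single (θ o).2.1 1) (Φ.symm o)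
  simp only [← Equiv.sum_comp Φ, Fintype.sum_sum_type, Equiv.symm_apply_apply, Sum.elim_inl,
    Sum.elim_inr] at hsum
  have hdummy : ∀ o : Dummy, c (Φ (.inr o)) = 0 := by
    intro o
    let t : T := (θ o).2
    let S : Fin (q + 1) → ℝ := fun j => ∑ o : Dummy,
      if vertexColor F (Φ (.inr o)) = j then
        c (Φ (.inr o)) * (Pi.single (θ o).2.1 1 : C → ℝ) t.1 else 0
    have hS : ∀ j, S j = S 0 := by
      intro j
      have hV : ∀ v, Function.extend κ₀ (x v) 0 t.1 = 0 := fun v =>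
        Function.extend_apply' _ _ _ t.2
      simpa [hV] using hsum t.1 j
    have hnsurj : ¬ Function.Surjective
        fun i : Fin q => vertexColor F (Φ (.inr (θ.symm (i, t)))) := by
      intro h
      have := Fintype.card_le_of_surjective _ h
      simp at this
    simp only [Function.Surjective, not_forall, not_exists] at hnsurj
    obtain ⟨j₀, hj₀⟩ := hnsurj
    have hS0 : S j₀ = 0 := by
      refine Finset.sum_eq_zero fun o' _ => ?_
      by_cases ht : (θ o').2 = t
      · rw [if_neg]
        have := hj₀ (θ o').1
        rwa [← ht, Prod.mk.eta, Equiv.symm_apply_apply] at this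
      · have ht' : t.1 ≠ (θ o').2.1 := fun h => ht (Subtype.ext h.symm)
        simp [ht']
    have hSo : S (vertexColor F (Φ (.inr o))) = 0 := by
      rw [hS, ← hS j₀, hS0]
    have hnn : ∀ o' ∈ (univ : Finset Dummy), 0 ≤
        if vertexColor F (Φ (.inr o')) = vertexColor F (Φ (.inr o)) then
          c (Φ (.inr o')) * (Pi.single (θ o').2.1 1 : C → ℝ) t.1 else 0 := by
      intro o' _
      split_ifs
      · refine mul_nonneg (hc _) ?_
        rw [Pi.single_apply]
        split_ifs <;> norm_num
      · exact le_rfl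
    simpa [t] using (Finset.sum_eq_zero_iff_of_nonneg hnn).1 hSo o (mem_univ o)
  refine ⟨fun v => vertexColor F (Φ (.inl v)), fun v => c (Φ (.inl v)), fun v => hc _, ?_, ?_, ?_⟩
  · intro h
    apply hne
    funext o
    obtain ⟨s, rfl⟩ := Φ.surjective o
    rcases s with v | o
    · exact congrFun h v
    · exact hdummy o
  · intro u v huv h
    simp only [hΦl, vertexColor_some] at h
    have h2 : (e u).2 = (e v).2 := huv
    rw [h2] at h
    exact he (Prod.ext (Fin.succ_injective _ ((F _).injective h)) h2)
  · intro k j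
    have h := hsum (κ₀ k) j
    simpa [hdummy, κ₀.injective.extend_apply] using h

lemma sum_smul_eq_zero_of_disjoint_hulls {V E : Type*} [Fintype V] [DecidableEq V]
    [AddCommGroup E] [Module ℝ E] (a : V → E) (μ : Finset V)
    (hsep : convexHull ℝ (a '' ↑μ) ∩ convexHull ℝ (a '' ↑μᶜ) = ∅) (w : V → ℝ)
    (hw : ∀ v, 0 ≤ w v) (hsum : ∑ v ∈ μ, w v = ∑ v ∈ μᶜ, w v)
    (hbary : ∑ v ∈ μ, w v • a v = ∑ v ∈ μᶜ, w v • a v) : w = 0 := by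
  have h0 : ∑ v ∈ μ, w v = 0 := by
    by_contra hne
    have hpos : 0 < ∑ v ∈ μ, w v := lt_of_le_of_ne (sum_nonneg fun v _ => hw v) (Ne.symm hne)
    have h1 := centerMass_mem_convexHull μ (fun v _ => hw v) hpos
      (fun v hv => Set.mem_image_of_mem a (mem_coe.2 hv))
    have h2 := centerMass_mem_convexHull μᶜ (fun v _ => hw v) (hsum ▸ hpos)
      (fun v hv => Set.mem_image_of_mem a (mem_coe.2 hv))
    have heq : μ.centerMass w a = μᶜ.centerMass w a := by
      rw [centerMass, centerMass, hsum, hbary]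
    rw [← heq] at h2
    exact (Set.eq_empty_iff_forall_notMem.1 hsep) _ ⟨h1, h2⟩
  funext v
  by_cases hv : v ∈ μ
  · exact (sum_eq_zero_iff_of_nonneg fun v _ => hw v).1 h0 v hv
  · exact (sum_eq_zero_iff_of_nonneg fun v _ => hw v).1 (hsum ▸ h0) v (mem_compl.2 hv)

end ColoredTverberg

/-- **Plus minus optimal colored Tverberg theorem.**
Vertices of the simplex `Δ_N` are modeled by `Fin (N+1)`, faces by finsets of vertices,
and the affine map `a : Δ_N → ℝ^d` by its values on the vertices.
The vertex set is partitioned into `m+1` color classes `C 0, …, C m`, each of cardinality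
at most `r - 1`. The face `μ` has at most `r - 1` vertices and `a(μ) ∩ a(μ') = ∅`,
where `μ' = μᶜ` is the complementary face. The resulting faces `σ j` are rainbow faces. -/
theorem plus_minus_optimal_colored_tverberg
    (d r : ℕ) (hd : 1 ≤ d) (hr : 2 ≤ r) (hrp : r.Prime)
    (N : ℕ) (hN : N = (r - 1) * (d + 1))
    (a : Fin (N + 1) → EuclideanSpace ℝ (Fin d))
    (μ : Finset (Fin (N + 1))) (hμcard : μ.card ≤ r - 1)
    (hsep : convexHull ℝ (a '' ↑μ) ∩ convexHull ℝ (a '' ↑μᶜ) = ∅)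
    (m : ℕ) (C : Fin (m + 1) → Finset (Fin (N + 1)))
    (hCdisj : ∀ i k, i ≠ k → Disjoint (C i) (C k))
    (hCcover : ∀ v : Fin (N + 1), ∃ i, v ∈ C i)
    (hCcard : ∀ i, (C i).card ≤ r - 1) :
    ∃ (σ : Fin r → Finset (Fin (N + 1))) (b : EuclideanSpace ℝ (Fin d))
      (α : Fin (N + 1) → ℝ),
      (∀ j, (σ j).Nonempty) ∧
      (∀ j, σ j ≠ Finset.univ) ∧
      (∀ j k, j ≠ k → Disjoint (σ j) (σ k)) ∧
      (∀ j, ∑ v ∈ σ j, α v • a v = b) ∧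
      (∀ j, ∑ v ∈ σ j, α v = 1) ∧
      (∀ v, (∃ j, v ∈ σ j) → (v ∈ μ → α v ≤ 0) ∧ (v ∉ μ → 0 ≤ α v)) ∧
      (∀ i j, (C i ∩ σ j).card ≤ 1) := by
  classical
  obtain ⟨q, rfl⟩ : ∃ q, r = q + 1 := ⟨r - 1, by omega⟩
  simp only [Nat.add_sub_cancel] at hN hμcard hCcard
  have : Fact (q + 1).Prime := ⟨hrp⟩
  choose col hcolC using hCcover
  have hcolC' : ∀ i v, v ∈ C i → col v = i := by
    intro i v hv
    by_contra hne
    exact Finset.disjoint_left.1 (hCdisj _ _ hne) (hcolC v) hv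
  -- homogenize, with the vertices of `μ` reflected
  let ε : Fin (N + 1) → ℝ := fun v => if v ∈ μ then -1 else 1
  let x : Fin (N + 1) → Option (Fin d) → ℝ := fun v k => ε v * k.elim 1 (a v)
  obtain ⟨g, w, hw, hne, hinj, hsum⟩ := ColoredTverberg.exists_rainbow_equal_sums (q := q)
    (by simp [hN]) x col fun c => (Finset.card_le_card fun v hv => by
      rw [Finset.mem_filter] at hv
      rw [← hv.2]
      exact hcolC v).trans (hCcard c)
  let σ : Fin (q + 1) → Finset (Fin (N + 1)) := fun j => Finset.univ.filter fun v => g v = j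
  have hσ : ∀ v j, v ∈ σ j ↔ g v = j := fun v j => by simp [σ]
  let β : Fin (N + 1) → ℝ := fun v => ε v * w v
  set s : ℝ := ∑ v ∈ σ 0, β v with hs
  set b : EuclideanSpace ℝ (Fin d) := ∑ v ∈ σ 0, β v • a v with hb
  have hβ : ∀ j, ∑ v ∈ σ j, β v = s := by
    intro j
    have h := hsum none j
    rw [← Finset.sum_filter, ← Finset.sum_filter] at h
    simpa [x, β, s, σ, mul_comm] using h
  have hβa : ∀ j, ∑ v ∈ σ j, β v • a v = b := by
    intro j
    ext k
    have h := hsum (some k) j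
    rw [← Finset.sum_filter, ← Finset.sum_filter] at h
    simpa [x, β, b, σ, mul_comm, mul_assoc, mul_left_comm] using h
  obtain ⟨j₀, hj₀⟩ : ∃ j₀, ∀ v ∈ σ j₀, v ∉ μ := by
    by_contra! hcon
    choose f hf hfμ using hcon
    have hfinj : Function.Injective f := fun j k hjk => by
      rw [← (hσ _ _).1 (hf j), ← (hσ _ _).1 (hf k), hjk]
    have := Finset.card_le_card_of_injOn f (s := Finset.univ) (t := μ) (fun j _ => hfμ j)
      hfinj.injOn
    simp at this
    omega
  have hβ₀ : ∀ v ∈ σ j₀, β v = w v := fun v hv => by simp [β, ε, hj₀ v hv]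
  have hsw : s = ∑ v ∈ σ j₀, w v := by
    rw [← hβ j₀, Finset.sum_congr rfl hβ₀]
  have hspos : 0 < s := by
    refine lt_of_le_of_ne (hsw ▸ Finset.sum_nonneg fun v _ => hw v) fun hs0 => hne ?_
    have hw₀ : ∀ v ∈ σ j₀, w v = 0 :=
      (Finset.sum_eq_zero_iff_of_nonneg fun v _ => hw v).1 (hsw ▸ hs0.symm)
    have hb0 : b = 0 := by
      rw [← hβa j₀]
      exact Finset.sum_eq_zero fun v hv => by rw [hβ₀ v hv, hw₀ v hv, zero_smul]
    have htot : ∑ v, β v = 0 := by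
      rw [← Finset.sum_fiberwise Finset.univ g]
      exact Finset.sum_eq_zero fun j _ => (hβ j).trans hs0.symm
    have htota : ∑ v, β v • a v = 0 := by
      rw [← Finset.sum_fiberwise Finset.univ g]
      exact Finset.sum_eq_zero fun j _ => (hβa j).trans hb0
    have hβμ : ∀ v ∈ μ, β v = -w v := fun v hv => by simp [β, ε, hv]
    have hβμ' : ∀ v ∈ μᶜ, β v = w v := fun v hv => by simp [β, ε, Finset.mem_compl.1 hv]
    refine ColoredTverberg.sum_smul_eq_zero_of_disjoint_hulls a μ hsep w hw ?_ ?_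
    · rw [← Finset.sum_add_sum_compl μ, Finset.sum_congr rfl hβμ, Finset.sum_congr rfl hβμ',
        Finset.sum_neg_distrib, neg_add_eq_zero] at htot
      exact htot
    · have hl : ∑ v ∈ μ, β v • a v = ∑ v ∈ μ, -(w v • a v) :=
        Finset.sum_congr rfl fun v hv => by rw [hβμ v hv, neg_smul]
      have hr : ∑ v ∈ μᶜ, β v • a v = ∑ v ∈ μᶜ, w v • a v :=
        Finset.sum_congr rfl fun v hv => by rw [hβμ' v hv]
      rw [← Finset.sum_add_sum_compl μ, hl, hr, Finset.sum_neg_distrib, neg_add_eq_zero] at htota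
      exact htota
  have hne' : ∀ j, (σ j).Nonempty := by
    intro j
    rw [Finset.nonempty_iff_ne_empty]
    intro h
    have := hβ j
    rw [h, Finset.sum_empty] at this
    exact hspos.ne this
  have hdisj : ∀ j k, j ≠ k → Disjoint (σ j) (σ k) := fun j k hjk =>
    Finset.disjoint_left.2 fun v hj hk => hjk (((hσ v j).1 hj).symm.trans ((hσ v k).1 hk))
  refine ⟨σ, s⁻¹ • b, fun v => s⁻¹ * β v, hne', ?_, hdisj, ?_, ?_, ?_, ?_⟩
  · intro j h
    have : Nontrivial (Fin (q + 1)) := Fin.nontrivial_iff_two_le.2 hr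
    obtain ⟨k, hk⟩ := exists_ne j
    obtain ⟨v, hv⟩ := hne' k
    exact Finset.disjoint_left.1 (hdisj k j hk) hv (h ▸ Finset.mem_univ v)
  · intro j
    simp only [mul_smul, ← Finset.smul_sum, hβa]
  · intro j
    rw [← Finset.mul_sum, hβ, inv_mul_cancel₀ hspos.ne']
  · intro v _
    have hsi : 0 ≤ s⁻¹ := (inv_pos.2 hspos).le
    refine ⟨fun hv => ?_, fun hv => ?_⟩
    · exact mul_nonpos_of_nonneg_of_nonpos hsi (by simpa [β, ε, hv] using hw v)
    · exact mul_nonneg hsi (by simpa [β, ε, hv] using hw v)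
  · intro i j
    refine Finset.card_le_one.2 fun u hu v hv => ?_
    rw [Finset.mem_inter, hσ] at hu hv
    exact hinj u v ((hcolC' i u hu.1).trans (hcolC' i v hv.1).symm) (hu.2.trans hv.2.symm)
end

section
/- Let d ≥ 1 be an integer, let r ≥ 2 be a prime, and set N = (r−1)(d+1). Let a : Δ_N → ℝ^d be an affine map, and let μ be a face of Δ_N of dimension at most r−2 (that is, card(vert(μ)) ≤ r−1) such that a(μ) ∩ a(μ') = ∅. Then there exist r pairwise disjoint nonempty proper faces σ_1,…,σ_r of Δ_N, a point b ∈ ℝ^d, and real coefficients α_v for v ∈ vert(σ_1) ∪ … ∪ vert(σ_r), such that for every j ∈ {1,…,r}: b = Σ_{v ∈ vert(σ_j)} α_v a(v) and Σ_{v ∈ vert(σ_j)} α_v = 1, with α_v ≤ 0 for every v ∈ vert(μ) and α_v ≥ 0 for every v ∈ vert(μ'), and in addition card(vert(μ) ∩ vert(σ_j)) ≤ 1 for every 1 ≤ j ≤ r; that is, in each affine representation Σ_{v ∈ vert(σ_j)} α_v a(v) of b there is at most one vertex v ∈ vert(σ_j) whose coefficient α_v is non-positive. -/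
open Classical in
/-- The integer `1` if `P` holds and `0` otherwise. -/
noncomputable def propIndicator (P : Prop) : ℤ := if P then 1 else 0

theorem propIndicator_of_true {P : Prop} (h : P) : propIndicator P = 1 := if_pos h

theorem propIndicator_of_false {P : Prop} (h : ¬P) : propIndicator P = 0 := if_neg h

/-- Among pairwise non-parallel vectors of the plane, the number of vectors having all others
strictly on their left equals the number of vectors having all others strictly on their right. -/
theorem sum_source_sub_sink_eq_zero {K : Type*} [Fintype K] [Nontrivial K] (g h : K → ℝ)
    (hg : ∀ i j, i ≠ j → g i * h j - g j * h i ≠ 0) :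
    ∑ i, (propIndicator (∀ j, j ≠ i → 0 < g i * h j - g j * h i) -
      propIndicator (∀ j, j ≠ i → g i * h j - g j * h i < 0)) = 0 := by
  classical
  have exists_sink : ∀ (h : K → ℝ), (∀ i j, i ≠ j → g i * h j - g j * h i ≠ 0) →
      (∃ i, ∀ j, j ≠ i → 0 < g i * h j - g j * h i) →
      ∃ i, ∀ j, j ≠ i → g i * h j - g j * h i < 0 := by
    rintro h hg ⟨i, hi⟩
    obtain ⟨l, hl⟩ := exists_ne i
    obtain ⟨j, hj, hmin⟩ := Finset.exists_min_image ({j | j ≠ i} : Finset K)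
      (fun j => (g i * g j + h i * h j) / (g i * h j - g j * h i)) ⟨l, by simpa using hl⟩
    have hji : j ≠ i := by simpa using hj
    refine ⟨j, fun k hk => ?_⟩
    rcases eq_or_ne k i with rfl | hki
    · linarith [hi j hji]
    have h1 := hmin k (by simpa using hki)
    have hqj := hi j hji
    have hqk := hi k hki
    rw [div_le_div_iff₀ hqj hqk] at h1
    have hn : 0 < g i ^ 2 + h i ^ 2 := by
      by_contra hcon
      have h1 : g i = 0 := by nlinarith [sq_nonneg (g i), sq_nonneg (h i)]
      have h2 : h i = 0 := by nlinarith [sq_nonneg (g i), sq_nonneg (h i)]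
      rw [h1, h2] at hqj
      linarith
    have h2 : (g i ^ 2 + h i ^ 2) * (g j * h k - g k * h j) ≤ 0 := by nlinarith
    exact lt_of_le_of_ne (by by_contra hcon; nlinarith) (hg j k hk.symm)
  have unique : ∀ (h : K → ℝ),
      ∑ i, propIndicator (∀ j, j ≠ i → 0 < g i * h j - g j * h i) =
        propIndicator (∃ i, ∀ j, j ≠ i → 0 < g i * h j - g j * h i) := by
    intro h
    by_cases hex : ∃ i, ∀ j, j ≠ i → 0 < g i * h j - g j * h i
    · rw [propIndicator_of_true hex]
      obtain ⟨i, hi⟩ := hex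
      rw [Finset.sum_eq_single i, propIndicator_of_true hi]
      · intro k _ hk
        refine propIndicator_of_false fun hk' => ?_
        linarith [hi k hk, hk' i hk.symm]
      · simp
    · rw [propIndicator_of_false hex]
      push Not at hex
      refine Finset.sum_eq_zero fun i _ => propIndicator_of_false ?_
      push Not
      exact hex i
  have hswap : ∀ i j, g i * h j - g j * h i < 0 ↔ 0 < g i * (-h) j - g j * (-h) i := by
    intro i j
    simp only [Pi.neg_apply]
    constructor <;> intro <;> linarith
  have hswap' : ∀ i j, 0 < g i * h j - g j * h i ↔ g i * (-h) j - g j * (-h) i < 0 := by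
    intro i j
    simp only [Pi.neg_apply]
    constructor <;> intro <;> linarith
  rw [Finset.sum_sub_distrib, unique h]
  have hiff : (∃ i, ∀ j, j ≠ i → 0 < g i * h j - g j * h i) ↔
      (∃ i, ∀ j, j ≠ i → 0 < g i * (-h) j - g j * (-h) i) := by
    constructor
    · intro hh
      simpa only [hswap] using exists_sink h hg hh
    · intro hh
      simp only [hswap']
      refine exists_sink (-h) (fun i j hij => ?_) hh
      have := hg i j hij
      simp only [Pi.neg_apply]
      intro h0
      exact this (by linarith)
  simp only [hswap]
  rw [unique (-h), hiff, sub_self]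

section CaptureSign

variable {V : Type*} [Fintype V] [DecidableEq V]

/-- The signed indicator of the origin lying in the interior of the simplex spanned by `w` and
the rows of `x`. -/
noncomputable def captureSign (w : V → ℝ) (x : Matrix V V ℝ) : ℤ :=
  propIndicator (0 < x.det ∧ ∀ v, (x.updateRow v w).det < 0) -
    propIndicator (x.det < 0 ∧ ∀ v, 0 < (x.updateRow v w).det)

theorem captureSign_mul (w : V → ℝ) (x A : Matrix V V ℝ) (hA : A.det ≠ 0) :
    captureSign (Matrix.vecMul w A) (x * A) =
      (SignType.sign A.det : ℤ) * captureSign w x := by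
  simp only [captureSign, ← Matrix.updateRow_mul, Matrix.det_mul]
  rcases hA.lt_or_gt with h | h
  · have hpos : ∀ t, 0 < t * A.det ↔ t < 0 := fun t =>
      ⟨fun _ => by nlinarith, fun _ => by nlinarith⟩
    have hneg : ∀ t, t * A.det < 0 ↔ 0 < t := fun t =>
      ⟨fun _ => by nlinarith, fun _ => by nlinarith⟩
    simp [hpos, hneg, h]
  · simp [mul_neg_iff, h, h.not_gt]

theorem det_one_updateRow (v : V) (w : V → ℝ) :
    ((1 : Matrix V V ℝ).updateRow v w).det = w v := by
  rw [← Matrix.cramer_transpose_apply]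
  simp

theorem det_one_updateRow_updateRow {u v : V} (huv : u ≠ v) (w w' : V → ℝ) :
    (((1 : Matrix V V ℝ).updateRow v w').updateRow u w).det = w u * w' v - w v * w' u := by
  have key := congrFun (Matrix.mulVec_cramer ((1 : Matrix V V ℝ).updateRow v w').transpose w) u
  have hsum : ∀ s, (if s ≠ u ∧ s ≠ v then (1 : Matrix V V ℝ).updateRow v w' s u else 0) = 0 := by
    intro s
    split_ifs with h
    · simp [h.1, h.2]
    · rfl
  rw [Matrix.mulVec, dotProduct, ← Finset.add_sum_erase _ _ (Finset.mem_univ u),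
    ← Finset.add_sum_erase _ _ (Finset.mem_erase.2 ⟨huv.symm, Finset.mem_univ v⟩),
    Finset.sum_eq_zero] at key
  · simp only [Matrix.cramer_transpose_apply, Matrix.transpose_apply, Matrix.updateRow_self,
      Matrix.updateRow_ne huv, Matrix.one_apply_eq, Matrix.updateRow_idem,
      det_one_updateRow, Matrix.det_transpose, Pi.smul_apply, smul_eq_mul] at key
    linarith
  · intro s hs
    simp only [Finset.mem_erase] at hs
    simp [Matrix.updateRow_ne hs.1, hs.2.1]

theorem captureSign_one_cocycle (w w' : V → ℝ) (hw : ∀ v, w v ≠ 0) (hw' : ∀ v, w' v ≠ 0)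
    (hww' : ∀ u v, u ≠ v → w u * w' v - w v * w' u ≠ 0) :
    captureSign w' 1 - captureSign w 1 +
      ∑ v, captureSign w ((1 : Matrix V V ℝ).updateRow v w') = 0 := by
  have key := sum_source_sub_sink_eq_zero (K := Option (Option V))
    (fun i => i.elim (-1) fun j => j.elim 0 w) (fun i => i.elim 0 fun j => j.elim (-1) w') (by
      rintro (_ | _ | i) (_ | _ | j) hij <;> simp_all)
  simp only [Fintype.sum_option] at key
  have hone : ∀ z : V → ℝ, captureSign z 1 = propIndicator (∀ v, z v < 0) := fun z => by
    simp [captureSign, det_one_updateRow, zero_lt_one.not_gt, propIndicator]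
  rw [hone, hone, ← key]
  have hrow : ∀ v u, (((1 : Matrix V V ℝ).updateRow v w').updateRow u w).det =
      if u = v then w v else w u * w' v - w v * w' u := by
    intro v u
    split_ifs with h
    · rw [h, Matrix.updateRow_idem, det_one_updateRow]
    · exact det_one_updateRow_updateRow h w w'
  have hsome : ∀ v, captureSign w ((1 : Matrix V V ℝ).updateRow v w') =
      propIndicator ((0 < w' v ∧ w v < 0) ∧ ∀ u, u ≠ v → w u * w' v - w v * w' u < 0) -
      propIndicator ((w' v < 0 ∧ 0 < w v) ∧ ∀ u, u ≠ v → 0 < w u * w' v - w v * w' u) := by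
    intro v
    simp only [captureSign, hrow, det_one_updateRow, and_assoc]
    have hforall : ∀ (P : ℝ → Prop) (a : ℝ) (b : V → ℝ),
        (∀ u, P (if u = v then a else b u)) ↔ P a ∧ ∀ u, u ≠ v → P (b u) := by
      refine fun P a b => ⟨fun h => ⟨by simpa using h v, fun u hu => by simpa [hu] using h u⟩,
        fun h u => ?_⟩
      split_ifs with hu
      exacts [h.1, h.2 u hu]
    rw [hforall (· < 0), hforall (0 < ·)]
  simp only [hsome, Option.forall]
  simp [and_assoc, sub_eq_add_neg, propIndicator_of_false]
  rw [add_assoc]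

theorem captureSign_cocycle (w w' : V → ℝ) (x : Matrix V V ℝ) (hx : x.det ≠ 0)
    (hw : ∀ v, (x.updateRow v w).det ≠ 0) (hw' : ∀ v, (x.updateRow v w').det ≠ 0)
    (hww' : ∀ u v, u ≠ v → ((x.updateRow v w').updateRow u w).det ≠ 0) :
    captureSign w' x - captureSign w x + ∑ v, captureSign w (x.updateRow v w') = 0 := by
  have hunit : IsUnit x.det := isUnit_iff_ne_zero.2 hx
  obtain ⟨z, rfl⟩ : ∃ z, Matrix.vecMul z x = w :=
    ⟨Matrix.vecMul w x⁻¹, by rw [Matrix.vecMul_vecMul, Matrix.nonsing_inv_mul _ hunit,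
      Matrix.vecMul_one]⟩
  obtain ⟨z', rfl⟩ : ∃ z, Matrix.vecMul z x = w' :=
    ⟨Matrix.vecMul w' x⁻¹, by rw [Matrix.vecMul_vecMul, Matrix.nonsing_inv_mul _ hunit,
      Matrix.vecMul_one]⟩
  have hrow : ∀ v z, x.updateRow v (Matrix.vecMul z x) =
      (1 : Matrix V V ℝ).updateRow v z * x := fun v z => by
    rw [Matrix.updateRow_mul, one_mul]
  have hone : ∀ z, captureSign (Matrix.vecMul z x) x =
      (SignType.sign x.det : ℤ) * captureSign z 1 := fun z => by
    rw [← captureSign_mul _ _ _ hx, one_mul]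
  simp only [hrow, ← Matrix.updateRow_mul, captureSign_mul _ _ _ hx, hone, Matrix.det_mul,
    ne_eq, mul_eq_zero, hx, or_false, det_one_updateRow] at *
  rw [← Finset.mul_sum, ← mul_sub, ← mul_add, captureSign_one_cocycle z z' hw hw', mul_zero]
  intro u v huv
  rw [← det_one_updateRow_updateRow huv]
  exact hww' u v huv

end CaptureSign

section Chessboard

variable {ι Q : Type*} [Fintype ι] {n : ℕ}

/-- The vertices of the product of chessboard complexes over `ι` with `n` columns and `n + 1` rows:
the maximal cell attached to `π` contains, for every column `v`, the row `π v.1 v.2.succ`. -/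
def chessboardCell (R : Q → Fin (n + 1) → ι × Fin n → ℝ) (m : ι × Fin n → Q)
    (π : ι → Equiv.Perm (Fin (n + 1))) : Matrix (ι × Fin n) (ι × Fin n) ℝ :=
  fun v => R (m v) (π v.1 v.2.succ)

/-- The orientation of the cell attached to `π`. -/
def cellSign (π : ι → Equiv.Perm (Fin (n + 1))) : ℤ := ∏ i, (Equiv.Perm.sign (π i) : ℤ)

theorem cellSign_mul (π τ : ι → Equiv.Perm (Fin (n + 1))) :
    cellSign (π * τ) = cellSign π * cellSign τ := by
  simp [cellSign, Finset.prod_mul_distrib]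

variable [DecidableEq ι]

/-- The signed number of cells which together with `w` capture the origin. -/
noncomputable def chessboardDegree (R : Q → Fin (n + 1) → ι × Fin n → ℝ) (m : ι × Fin n → Q)
    (w : ι × Fin n → ℝ) : ℤ :=
  ∑ π, cellSign π * captureSign w (chessboardCell R m π)

/-- Vectors with distinct labels in `Q` are linearly independent. -/
def InGeneralPosition (R : Q → Fin (n + 1) → ι × Fin n → ℝ) : Prop :=
  ∀ (m : ι × Fin n → Q) (j : ι × Fin n → Fin (n + 1)), Function.Injective m →
    Matrix.det (fun v => R (m v) (j v) : Matrix (ι × Fin n) (ι × Fin n) ℝ) ≠ 0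

/-- The product of chessboard complexes is a cycle: the two cells sharing a facet have opposite
orientations. -/
theorem sum_cellSign_mul_updateRow_eq_zero (R : Q → Fin (n + 1) → ι × Fin n → ℝ)
    (m : ι × Fin n → Q) (w : ι × Fin n → ℝ) (v : ι × Fin n)
    (y : (ι → Equiv.Perm (Fin (n + 1))) → ι × Fin n → ℝ)
    (hy : ∀ π, y (π * Pi.mulSingle v.1 (Equiv.swap 0 v.2.succ)) = y π) :
    ∑ π, cellSign π * captureSign w ((chessboardCell R m π).updateRow v (y π)) = 0 := by
  set τ : ι → Equiv.Perm (Fin (n + 1)) := Pi.mulSingle v.1 (Equiv.swap 0 v.2.succ) with hτ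
  have hτsign : cellSign τ = -1 := by
    rw [cellSign, Finset.prod_eq_single v.1]
    · simp [hτ, Equiv.Perm.sign_swap (Fin.succ_ne_zero v.2).symm]
    · intro i _ hi
      simp [hτ, hi]
    · simp
  have hττ : τ * τ = 1 := by
    rw [hτ, ← Pi.mulSingle_mul, Equiv.swap_mul_self, Pi.mulSingle_one]
  refine Finset.sum_involution (fun π _ => π * τ) ?_ ?_ (by simp) ?_
  · intro π _
    have : (chessboardCell R m (π * τ)).updateRow v (y (π * τ)) =
        (chessboardCell R m π).updateRow v (y π) := by
      rw [hy]
      ext u : 1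
      rcases eq_or_ne u v with rfl | huv
      · simp
      · simp only [ne_eq, huv, not_false_eq_true, Matrix.updateRow_ne]
        obtain ⟨i, s⟩ := u
        rcases eq_or_ne i v.1 with rfl | hi
        · have hs : s.succ ≠ v.2.succ := fun h => huv (Prod.ext rfl (Fin.succ_injective _ h))
          simp [chessboardCell, hτ, Equiv.swap_apply_of_ne_of_ne (Fin.succ_ne_zero s) hs]
        · simp [chessboardCell, hτ, hi]
    rw [this, cellSign_mul, hτsign]
    ring
  · intro π _ _ h
    have : τ = 1 := by simpa using h
    rw [this] at hτsign
    simp [cellSign] at hτsign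
  · intro π _
    rw [mul_assoc, hττ, mul_one]

variable {R : Q → Fin (n + 1) → ι × Fin n → ℝ}

theorem InGeneralPosition.cocycle (hR : InGeneralPosition R) {m : ι × Fin n → Q}
    (hm : Function.Injective m) (j : ι × Fin n → Fin (n + 1)) {z z' : Q}
    (hz : z ∉ Set.range m) (hz' : z' ∉ Set.range m) (hzz' : z ≠ z') (a b : Fin (n + 1)) :
    captureSign (R z' b) (fun v => R (m v) (j v)) - captureSign (R z a) (fun v => R (m v) (j v)) +
      ∑ v, captureSign (R z a)
        (Matrix.updateRow (fun v => R (m v) (j v)) v (R z' b)) = 0 := by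
  have hupd : ∀ (m : ι × Fin n → Q) (j : ι × Fin n → Fin (n + 1)) (v : ι × Fin n) (z : Q)
      (a : Fin (n + 1)),
      Matrix.updateRow (fun v => R (m v) (j v) : Matrix (ι × Fin n) (ι × Fin n) ℝ) v (R z a) =
        fun u => R (Function.update m v z u) (Function.update j v a u) := by
    intro m j v z a
    funext u
    change Function.update (fun v => R (m v) (j v)) v (R z a) u = _
    rcases eq_or_ne u v with rfl | huv
    · simp
    · simp [huv]
  have hinj : ∀ (m : ι × Fin n → Q) (v : ι × Fin n) (z : Q), Function.Injective m →
      z ∉ Set.range m → Function.Injective (Function.update m v z) := by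
    intro m v z hm hz x y hxy
    by_contra hne
    simp only [Function.update_apply] at hxy
    split_ifs at hxy with h1 h2 h2
    · exact hne (h1.trans h2.symm)
    · exact hz ⟨y, hxy.symm⟩
    · exact hz ⟨x, hxy⟩
    · exact hne (hm hxy)
  refine captureSign_cocycle _ _ _ (hR _ _ hm) (fun v => ?_) (fun v => ?_) fun u v huv => ?_
  · rw [hupd]
    exact hR _ _ (hinj _ _ _ hm hz)
  · rw [hupd]
    exact hR _ _ (hinj _ _ _ hm hz')
  · rw [hupd, hupd]
    refine hR _ _ (hinj _ _ _ (hinj _ _ _ hm hz') ?_)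
    rintro ⟨x, hx⟩
    simp only [Function.update_apply] at hx
    split_ifs at hx
    · exact hzz' hx.symm
    · exact hz ⟨x, hx⟩

theorem chessboardDegree_congr_point (hR : InGeneralPosition R) {m : ι × Fin n → Q}
    (hm : Function.Injective m) {z z' : Q} (hz : z ∉ Set.range m) (hz' : z' ∉ Set.range m)
    (hzz' : z ≠ z') (a b : Fin (n + 1)) :
    chessboardDegree R m (R z' b) = chessboardDegree R m (R z a) := by
  have key : ∑ π, cellSign π * (captureSign (R z' b) (chessboardCell R m π) -
      captureSign (R z a) (chessboardCell R m π) +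
      ∑ v, captureSign (R z a) ((chessboardCell R m π).updateRow v (R z' b))) = 0 :=
    Finset.sum_eq_zero fun π _ => mul_eq_zero_of_right _
      (hR.cocycle hm (fun v => π v.1 v.2.succ) hz hz' hzz' a b)
  simp only [mul_add, mul_sub, Finset.mul_sum, Finset.sum_add_distrib,
    Finset.sum_sub_distrib] at key
  rw [Finset.sum_comm, Finset.sum_eq_zero fun v _ =>
    sum_cellSign_mul_updateRow_eq_zero R m _ v (fun _ => R z' b) fun _ => rfl] at key
  simp only [chessboardDegree]
  linarith

/-- The sum of a function on tuples of permutations of `Fin (n + 1)` which is invariant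
under translation of the values is divisible by `n + 1`. -/
theorem sum_eq_zero_of_translation_invariant (f : (ι → Equiv.Perm (Fin (n + 1))) → ZMod (n + 1))
    (v : ι × Fin n)
    (hf : ∀ π (j : Fin (n + 1)), f (fun i => Equiv.addRight j * π i) = f π) : ∑ π, f π = 0 := by
  rw [← Finset.sum_fiberwise (g := fun π => π v.1 v.2.succ)]
  have : ∀ j : Fin (n + 1), ∑ π with π v.1 v.2.succ = j, f π =
      ∑ π with π v.1 v.2.succ = 0, f π := by
    intro j
    symm
    refine Finset.sum_equiv
      (Equiv.mulLeft (fun _ => Equiv.addRight j : ι → Equiv.Perm (Fin (n + 1)))) ?_ ?_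
    · intro π
      simp
    · intro π _
      exact (hf π j).symm
  simp [Finset.sum_congr rfl fun j _ => this j]

theorem chessboardDegree_update [Fact (n + 1).Prime] (hR : InGeneralPosition R)
    (B : Fin (n + 1) → Matrix (ι × Fin n) (ι × Fin n) ℝ) (hB : ∀ j, B j ^ (n + 1) = 1)
    (hRB : ∀ q a j, R q (a + j) = Matrix.vecMul (R q a) (B j))
    {m : ι × Fin n → Q} (hm : Function.Injective m) {z q : Q} (hz : z ∉ Set.range m)
    (hq : q ∉ Set.range m) (hzq : z ≠ q) (a : Fin (n + 1)) (v : ι × Fin n) :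
    (chessboardDegree R (Function.update m v q) (R z a) : ZMod (n + 1)) =
      chessboardDegree R m (R z a) := by
  have key : ∑ π, cellSign π * (captureSign (R q (π v.1 v.2.succ)) (chessboardCell R m π) -
      captureSign (R z a) (chessboardCell R m π) +
      ∑ u, captureSign (R z a) ((chessboardCell R m π).updateRow u (R q (π v.1 v.2.succ)))) = 0 :=
    Finset.sum_eq_zero fun π _ => mul_eq_zero_of_right _
      (hR.cocycle hm (fun v => π v.1 v.2.succ) hz hq hzq a _)
  simp only [mul_add, mul_sub, Finset.mul_sum, Finset.sum_add_distrib,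
    Finset.sum_sub_distrib] at key
  rw [Finset.sum_comm, Finset.sum_eq_single v ?_ (by simp)] at key
  · have hupd : ∀ π, (chessboardCell R m π).updateRow v (R q (π v.1 v.2.succ)) =
        chessboardCell R (Function.update m v q) π := by
      intro π
      ext u : 1
      rcases eq_or_ne u v with rfl | huv
      · simp [chessboardCell]
      · simp [chessboardCell, huv]
    have hinv : ∑ π, ((cellSign π * captureSign (R q (π v.1 v.2.succ)) (chessboardCell R m π) : ℤ) :
        ZMod (n + 1)) = 0 := by
      refine sum_eq_zero_of_translation_invariant _ v fun π j => ?_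
      have hBdet : (B j).det ^ (n + 1) = 1 := by rw [← Matrix.det_pow, hB, Matrix.det_one]
      have hcell : chessboardCell R m (fun i => Equiv.addRight j * π i) =
          chessboardCell R m π * B j := by
        ext u : 1
        simp only [chessboardCell, Equiv.Perm.coe_mul, Function.comp_apply, Equiv.coe_addRight, hRB]
        rfl
      have hsign : ((cellSign fun _ : ι => Equiv.addRight j) *
          (SignType.sign (B j).det : ℤ) : ZMod (n + 1)) = 1 := by
        have hadd : (Equiv.addRight j : Equiv.Perm (Fin (n + 1))) ^ (n + 1) = 1 := by
          have hj : (n + 1) • j = 0 := by simpa using card_nsmul_eq_zero (x := j)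
          ext x
          rw [Equiv.Perm.coe_pow, Equiv.coe_addRight, add_right_iterate, hj]
          simp
        have h1 : (cellSign fun _ : ι => Equiv.addRight j) ^ (n + 1) = 1 := by
          rw [cellSign, ← Finset.prod_pow]
          refine Finset.prod_eq_one fun _ _ => ?_
          rw [← Units.val_pow_eq_pow_val, ← map_pow, hadd]
          simp
        have h2 : (SignType.sign (B j).det : ℤ) ^ (n + 1) = 1 := by
          rw [← SignType.coe_pow, ← sign_pow, hBdet]
          simp
        rw [← ZMod.pow_card (_ * _ : ZMod (n + 1)), mul_pow, ← Int.cast_pow, h1,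
          ← Int.cast_pow, h2, Int.cast_one, mul_one]
      have hmul : cellSign (fun i => Equiv.addRight j * π i) =
          cellSign (fun _ : ι => Equiv.addRight j) * cellSign π :=
        cellSign_mul (fun _ => Equiv.addRight j) π
      rw [hcell, Equiv.Perm.coe_mul, Function.comp_apply, Equiv.coe_addRight, hRB,
        captureSign_mul _ _ _ (by rintro h0; simp [h0] at hBdet), hmul]
      push_cast at hsign ⊢
      linear_combination (cellSign π * captureSign (R q (π v.1 v.2.succ)) (chessboardCell R m π) :
        ZMod (n + 1)) * hsign
    have key' := congrArg (Int.cast : ℤ → ZMod (n + 1)) key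
    simp only [hupd] at key'
    push_cast at key' hinv
    rw [hinv] at key'
    simp only [chessboardDegree]
    push_cast
    linear_combination key'
  · intro u _ huv
    refine sum_cellSign_mul_updateRow_eq_zero R m _ u (fun π => R q (π v.1 v.2.succ)) fun π => ?_
    obtain ⟨i, s⟩ := v
    rcases eq_or_ne i u.1 with rfl | hi
    · have hs : s.succ ≠ u.2.succ := fun h => huv (Prod.ext rfl (Fin.succ_injective _ h).symm)
      simp [Equiv.swap_apply_of_ne_of_ne (Fin.succ_ne_zero s) hs]
    · simp [hi]

end Chessboard

section Simplex

variable {ι : Type*} [DecidableEq ι] {n : ℕ}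

/-- In each block `i`, the vertices of a simplex centered at the origin: the standard basis together
with the negative of its sum. -/
def simplexVertex (i : ι) (j : Fin (n + 1)) : ι × Fin n → ℝ :=
  fun u => if u.1 = i then Fin.cases (-1) (fun s => if u.2 = s then 1 else 0) j else 0

theorem simplexVertex_succ (i : ι) (s : Fin n) : simplexVertex i s.succ = Pi.single (i, s) 1 := by
  ext ⟨k, t⟩
  by_cases hk : k = i <;> by_cases ht : t = s <;> simp [simplexVertex, hk, ht]

theorem simplexVertex_zero_apply (i : ι) (t : Fin n) : simplexVertex i 0 (i, t) = -1 := by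
  simp [simplexVertex]

theorem simplexVertex_apply_of_ne {i k : ι} (h : k ≠ i) (j : Fin (n + 1)) (t : Fin n) :
    simplexVertex i j (k, t) = 0 := by
  simp [simplexVertex, h]

theorem sum_simplexVertex (i : ι) : ∑ j : Fin (n + 1), simplexVertex i j = 0 := by
  ext ⟨k, t⟩
  rw [Fin.sum_univ_succ]
  by_cases hk : k = i <;> simp [simplexVertex, hk]

theorem exists_decomposeFin_symm_eq {σ : Equiv.Perm (Fin (n + 1))} (hσ : σ 0 = 0) :
    ∃ e : Equiv.Perm (Fin n), σ = Equiv.Perm.decomposeFin.symm (0, e) := by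
  obtain ⟨⟨k, e⟩, rfl⟩ := Equiv.Perm.decomposeFin.symm.surjective σ
  rw [Equiv.Perm.decomposeFin_symm_apply_zero] at hσ
  exact ⟨e, by rw [hσ]⟩

variable [Fintype ι]

/-- The linear map, acting on row vectors, which cyclically permutes the simplex vertices of
every block. -/
def simplexShift (ι : Type*) [DecidableEq ι] [Fintype ι] (n : ℕ) :
    Matrix (ι × Fin n) (ι × Fin n) ℝ :=
  fun u => simplexVertex u.1 (u.2.succ + 1)

theorem simplexVertex_vecMul_shift (i : ι) (j : Fin (n + 1)) :
    Matrix.vecMul (simplexVertex i j) (simplexShift ι n) = simplexVertex i (j + 1) := by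
  have hsucc : ∀ s : Fin n, Matrix.vecMul (simplexVertex i s.succ) (simplexShift ι n) =
      simplexVertex i (s.succ + 1) := fun s => by
    rw [simplexVertex_succ, Matrix.single_one_vecMul]
    rfl
  refine Fin.cases ?_ hsucc j
  have h0 := congrArg (Matrix.vecMul · (simplexShift ι n)) (sum_simplexVertex (n := n) i)
  have h1 : ∑ j : Fin (n + 1), simplexVertex i (j + 1) = 0 := by
    rw [← sum_simplexVertex (n := n) i]
    exact Equiv.sum_comp (Equiv.addRight 1) (simplexVertex i)
  rw [Fin.sum_univ_succ] at h0 h1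
  simp only [Matrix.add_vecMul, Matrix.sum_vecMul, hsucc, Matrix.zero_vecMul] at h0
  exact add_right_cancel (h0.trans h1.symm)

theorem simplexVertex_vecMul_shift_pow (i : ι) (j : Fin (n + 1)) (k : ℕ) :
    Matrix.vecMul (simplexVertex i j) (simplexShift ι n ^ k) = simplexVertex i (j + k • 1) := by
  induction k with
  | zero => simp
  | succ k ih => rw [pow_succ, ← Matrix.vecMul_vecMul, ih, simplexVertex_vecMul_shift, succ_nsmul,
      add_assoc]

theorem simplexShift_pow : simplexShift ι n ^ (n + 1) = 1 := by
  have h : (n + 1) • (1 : Fin (n + 1)) = 0 := by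
    simpa using card_nsmul_eq_zero (x := (1 : Fin (n + 1)))
  refine funext fun u => ?_
  obtain ⟨i, s⟩ := u
  change Matrix.row (simplexShift ι n ^ (n + 1)) (i, s) = Matrix.row 1 (i, s)
  rw [← Matrix.single_one_vecMul, ← Matrix.single_one_vecMul, ← simplexVertex_succ,
    simplexVertex_vecMul_shift_pow, h, add_zero, Matrix.vecMul_one]

theorem simplexVertex_zero_vecMul_shift_pow (i : ι) (j : Fin (n + 1)) :
    Matrix.vecMul (simplexVertex i 0) (simplexShift ι n ^ (j : ℕ)) = simplexVertex i j := by
  rw [simplexVertex_vecMul_shift_pow, zero_add]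
  have h : ∀ (k : ℕ) (hk : k < n + 1), k • (1 : Fin (n + 1)) = ⟨k, hk⟩ := by
    intro k
    induction k with
    | zero => exact fun _ => zero_nsmul _
    | succ k ih =>
      intro hk
      rw [succ_nsmul, ih (by omega)]
      ext
      simp [Fin.val_add, Nat.mod_eq_of_lt hk]
  rw [h j j.isLt]

/-- The cell attached to `π` in the standard position. -/
def standardCell (π : ι → Equiv.Perm (Fin (n + 1))) : Matrix (ι × Fin n) (ι × Fin n) ℝ :=
  fun v => simplexVertex v.1 (π v.1 v.2.succ)

theorem det_standardCell_of_fix (π : ι → Equiv.Perm (Fin (n + 1))) (hπ : ∀ i, π i 0 = 0) :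
    (standardCell π).det = cellSign π ∧
      ∀ v, ((standardCell π).updateRow v (-1)).det = -cellSign π := by
  choose e he using fun i => exists_decomposeFin_symm_eq (hπ i)
  have hsign : cellSign π = Equiv.Perm.sign (Equiv.prodCongrRight e) := by
    simp [cellSign, he, Equiv.Perm.sign_prodCongrRight, Units.coe_prod,
      Equiv.Perm.decomposeFin.symm_sign]
  have hrow : ∀ v, standardCell π v = Pi.single (v.1, e v.1 v.2) 1 := by
    intro v
    rw [standardCell, he, Equiv.Perm.decomposeFin_symm_apply_succ, Equiv.swap_self]
    exact simplexVertex_succ _ _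
  have hperm : standardCell π = Equiv.Perm.permMatrix ℝ (Equiv.prodCongrRight e) := by
    ext v u
    rw [hrow, Equiv.Perm.permMatrix, PEquiv.toMatrix_apply, Pi.single_apply]
    simp only [Equiv.toPEquiv_apply, Option.mem_some_iff, eq_comm (a := u)]
    rfl
  have hdet : (standardCell π).det = cellSign π := by
    rw [hperm, Matrix.det_permutation, hsign]
  refine ⟨hdet, fun v => ?_⟩
  have hone : (-1 : ι × Fin n → ℝ) = ∑ u, (-1 : ℝ) • standardCell π u := by
    have hperm_sum := Equiv.sum_comp (Equiv.prodCongrRight e)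
      fun u => (-1 : ℝ) • (Pi.single u 1 : ι × Fin n → ℝ)
    have hrow' : ∀ u, standardCell π u = Pi.single (Equiv.prodCongrRight e u) 1 := hrow
    simp only [hrow', hperm_sum]
    ext u
    simp [Finset.sum_apply, Pi.single_apply]
  rw [hone, Matrix.det_updateRow_sum _ v fun _ => (-1 : ℝ), hdet]
  simp

theorem det_standardCell_ne_zero (π : ι → Equiv.Perm (Fin (n + 1))) :
    (standardCell π).det ≠ 0 := by
  intro h
  obtain ⟨z, hz0, hz⟩ := Matrix.exists_mulVec_eq_zero_iff.2 h
  refine hz0 (funext fun v => ?_)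
  have hv : ∀ j, simplexVertex v.1 j ⬝ᵥ z = 0 := by
    have hne : ∀ j, j ≠ π v.1 0 → simplexVertex v.1 j ⬝ᵥ z = 0 := by
      intro j hj
      obtain ⟨k, rfl⟩ := (π v.1).surjective j
      obtain ⟨s, rfl⟩ := Fin.exists_succ_eq.2 fun hk => hj (congrArg _ hk)
      exact congrFun hz (v.1, s)
    intro j
    by_cases hj : j = π v.1 0
    · have hsum : ∑ j, simplexVertex v.1 j ⬝ᵥ z = 0 := by
        rw [← sum_dotProduct, sum_simplexVertex, zero_dotProduct]
      rwa [Finset.sum_eq_single (π v.1 0) (fun j _ => hne j) (by simp), ← hj] at hsum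
    · exact hne j hj
  simpa [simplexVertex_succ] using hv v.2.succ

theorem det_standardCell_updateRow_of_not_fix (π : ι → Equiv.Perm (Fin (n + 1)))
    (hπ : ¬∀ i, π i 0 = 0) :
    ∃ v, ((standardCell π).updateRow v (-1)).det = (standardCell π).det := by
  push Not at hπ
  obtain ⟨i, hi⟩ := hπ
  obtain ⟨t, ht⟩ := Fin.exists_succ_eq.2 hi
  obtain ⟨k, hk⟩ := (π i).surjective 0
  obtain ⟨s, rfl⟩ := Fin.exists_succ_eq.2 fun h : k = 0 => hi (h ▸ hk)
  refine ⟨(i, s), ?_⟩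
  have hsub : ((standardCell π).updateRow (i, s) (-1 - standardCell π (i, s))).det = 0 := by
    refine Matrix.det_eq_zero_of_column_eq_zero (i, t) fun u => ?_
    rcases eq_or_ne u (i, s) with rfl | hu
    · simp [standardCell, hk, simplexVertex_zero_apply]
    · rw [Matrix.updateRow_ne hu]
      obtain ⟨l, q⟩ := u
      rcases eq_or_ne l i with rfl | hl
      · have h0 : π l q.succ ≠ 0 := by
          rw [← hk]
          intro h
          exact hu (Prod.ext rfl (Fin.succ_injective _ ((π l).injective h)))
        obtain ⟨q', hq'⟩ := Fin.exists_succ_eq.2 h0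
        have : t ≠ q' := by
          rintro rfl
          rw [hq'] at ht
          exact Fin.succ_ne_zero q ((π l).injective ht)
        simp [standardCell, ← hq', simplexVertex_succ, this]
      · exact simplexVertex_apply_of_ne hl.symm _ _
  have hadd := Matrix.det_updateRow_add (standardCell π) (i, s) (-1 - standardCell π (i, s))
    (standardCell π (i, s))
  rwa [sub_add_cancel, hsub, zero_add, Matrix.updateRow_eq_self] at hadd

theorem card_perm_tuples_fix :
    ∑ π : ι → Equiv.Perm (Fin (n + 1)), propIndicator (∀ i, π i 0 = 0) =
      (n.factorial : ℤ) ^ Fintype.card ι := by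
  classical
  have e : {σ : Equiv.Perm (Fin (n + 1)) // σ 0 = 0} ≃ Equiv.Perm (Fin n) :=
    { toFun := fun σ => (Equiv.Perm.decomposeFin σ.1).2
      invFun := fun τ => ⟨Equiv.Perm.decomposeFin.symm (0, τ), by simp⟩
      left_inv := by
        rintro ⟨σ, hσ⟩
        obtain ⟨e, rfl⟩ := exists_decomposeFin_symm_eq hσ
        simp
      right_inv := fun τ => by simp }
  have hcard : Fintype.card {π : ι → Equiv.Perm (Fin (n + 1)) // ∀ i, π i 0 = 0} =
      n.factorial ^ Fintype.card ι := by
    rw [Fintype.card_congr (Equiv.subtypePiEquivPi 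
        (p := fun (_ : ι) (σ : Equiv.Perm (Fin (n + 1))) => σ 0 = 0)),
      Fintype.card_pi]
    simp [Fintype.card_congr e, Fintype.card_perm]
  have hsum : ∑ π : ι → Equiv.Perm (Fin (n + 1)), propIndicator (∀ i, π i 0 = 0) =
      ∑ π : ι → Equiv.Perm (Fin (n + 1)), if ∀ i, π i 0 = 0 then 1 else 0 :=
    Finset.sum_congr rfl fun π _ => by simp [propIndicator]
  rw [hsum, Finset.sum_boole, ← Fintype.card_subtype, hcard]
  simp

end Simplex

section Rainbow

variable {V : Type*} [Fintype V] [DecidableEq V]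

theorem det_mul_det_updateRow_neg_of_captureSign_ne_zero {w : V → ℝ} {x : Matrix V V ℝ}
    (h : captureSign w x ≠ 0) (v : V) : x.det * (x.updateRow v w).det < 0 := by
  by_contra hv
  refine h ?_
  rw [captureSign, propIndicator_of_false, propIndicator_of_false, sub_zero]
  · exact fun h => hv (mul_neg_of_neg_of_pos h.1 (h.2 v))
  · exact fun h => hv (mul_neg_of_pos_of_neg h.1 (h.2 v))

/-- If `w` and the rows of `x` capture the origin, they do not lie in an open half-space. -/
theorem captureSign_eq_zero_of_forall_pos {w : V → ℝ} {x : Matrix V V ℝ} [Nonempty V]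
    (l : (V → ℝ) →ₗ[ℝ] ℝ) (hw : 0 < l w) (hx : ∀ v, 0 < l (x v)) : captureSign w x = 0 := by
  by_contra h
  have hneg := det_mul_det_updateRow_neg_of_captureSign_ne_zero h
  have hcramer : x.det • w = ∑ v, (x.updateRow v w).det • x v := by
    have := Matrix.mulVec_cramer x.transpose w
    rw [Matrix.det_transpose] at this
    rw [← this]
    ext u
    simp [Matrix.mulVec, dotProduct, Matrix.cramer_transpose_apply, mul_comm]
  have hl := congrArg (fun u => x.det * l u) hcramer
  simp only [map_sum, map_smul, smul_eq_mul, Finset.mul_sum] at hl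
  have h1 : 0 ≤ x.det * (x.det * l w) := by
    rw [← mul_assoc]
    exact mul_nonneg (mul_self_nonneg _) hw.le
  have h2 : ∑ v, x.det * ((x.updateRow v w).det * l (x v)) < 0 :=
    Finset.sum_neg (fun v _ => by
      rw [← mul_assoc]
      exact mul_neg_of_neg_of_pos (hneg v) (hx v)) Finset.univ_nonempty
  linarith

theorem dense_setOf_det_ne_zero {E : Type*} [TopologicalSpace E] [AddCommGroup E] [Module ℝ E]
    [ContinuousAdd E] [ContinuousSMul ℝ E] (L : E →ₗ[ℝ] Matrix V V ℝ) {y : E}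
    (hy : (L y).det ≠ 0) : Dense {x | (L x).det ≠ 0} := by
  intro x
  let P : Polynomial ℝ :=
    Matrix.det ((L x).map Polynomial.C +
      (Polynomial.X : Polynomial ℝ) • (L (y - x)).map Polynomial.C)
  have hP : ∀ t, P.eval t = (L (x + t • (y - x))).det := by
    intro t
    rw [← Polynomial.coe_evalRingHom, RingHom.map_det]
    congr 1
    ext i j
    simp
  have hP0 : P ≠ 0 := by
    intro h
    have := hP 1
    rw [h, one_smul, add_sub_cancel, Polynomial.eval_zero] at this
    exact hy this.symm
  have hfin : {t | P.eval t = 0}.Finite := by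
    refine P.roots.toFinset.finite_toSet.subset fun t ht => ?_
    simpa [hP0] using ht
  have hdense := hfin.countable.dense_compl ℝ (0 : ℝ)
  have hcont : Continuous fun t : ℝ => x + t • (y - x) := by fun_prop
  have hmem := map_mem_closure hcont hdense (t := {x | (L x).det ≠ 0}) fun t ht => by
    rw [Set.mem_ofPred_eq, ← hP]
    exact ht
  simpa using hmem

variable {ι Q : Type*} [Fintype ι] [DecidableEq ι] {n : ℕ}

/-- The orbits of the vectors `p q` under the shift of all simplices. -/
noncomputable def shiftOrbit (p : Q → ι × Fin n → ℝ) (q : Q) (j : Fin (n + 1)) : ι × Fin n → ℝ :=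
  Matrix.vecMul (p q) (simplexShift ι n ^ (j : ℕ))

theorem shiftOrbit_add (p : Q → ι × Fin n → ℝ) (q : Q) (j k : Fin (n + 1)) :
    shiftOrbit p q (j + k) = Matrix.vecMul (shiftOrbit p q j) (simplexShift ι n ^ (k : ℕ)) := by
  rw [shiftOrbit, shiftOrbit, Matrix.vecMul_vecMul, ← pow_add, Fin.val_add,
    ← pow_eq_pow_mod _ simplexShift_pow]

theorem shiftOrbit_zero (p : Q → ι × Fin n → ℝ) (q : Q) : shiftOrbit p q 0 = p q := by
  simp [shiftOrbit]

@[fun_prop]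
theorem continuous_shiftOrbit (q : Q) (j : Fin (n + 1)) :
    Continuous fun p : Q → ι × Fin n → ℝ => shiftOrbit p q j :=
  (continuous_apply q).matrix_vecMul continuous_const

theorem dense_inGeneralPosition [Finite Q] :
    Dense {p : Q → ι × Fin n → ℝ | InGeneralPosition (shiftOrbit p)} := by
  let M (m : ι × Fin n → Q) (j : ι × Fin n → Fin (n + 1)) :
      (Q → ι × Fin n → ℝ) →ₗ[ℝ] Matrix (ι × Fin n) (ι × Fin n) ℝ :=
    { toFun := fun p v => shiftOrbit p (m v) (j v)
      map_add' := fun p p' => funext fun v => Matrix.add_vecMul _ _ _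
      map_smul' := fun c p => funext fun v => Matrix.smul_vecMul c (p (m v)) _ }
  have hset : {p : Q → ι × Fin n → ℝ | InGeneralPosition (shiftOrbit p)} =
      ⋂ a : {m : ι × Fin n → Q // Function.Injective m} × (ι × Fin n → Fin (n + 1)),
        {p | (M a.1 a.2 p).det ≠ 0} := by
    ext p
    simp only [Set.mem_iInter, Set.mem_ofPred_eq]
    exact ⟨fun h a => h a.1 a.2 a.1.2, fun h m j hm => h (⟨m, hm⟩, j)⟩
  rw [hset]
  refine dense_iInter_of_isOpen (fun a => ?_) fun a => ?_
  · refine isOpen_ne_fun (Continuous.matrix_det ?_) continuous_const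
    exact continuous_pi fun v => continuous_shiftOrbit _ _
  · obtain ⟨⟨m, hm⟩, j⟩ := a
    refine dense_setOf_det_ne_zero (M m j) (y := Function.extend m
      (fun v => Matrix.vecMul (Pi.single v 1) (simplexShift ι n ^ (n * (j v : ℕ)))) 0) ?_
    have : M m j (Function.extend m
      (fun v => Matrix.vecMul (Pi.single v 1) (simplexShift ι n ^ (n * (j v : ℕ)))) 0) = 1 := by
      refine funext fun v => ?_
      change Matrix.vecMul _ _ = Matrix.row 1 v
      rw [hm.extend_apply, Matrix.vecMul_vecMul, ← pow_add, ← Nat.succ_mul, Nat.succ_eq_add_one,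
        pow_mul, simplexShift_pow, one_pow, Matrix.single_one_vecMul]
    rw [this, Matrix.det_one]
    exact one_ne_zero

open Filter Topology in
/-- The degree is known close to the standard position. -/
theorem eventually_chessboardDegree_eq {m : ι × Fin n → Q} {z : Q} {p₀ : Q → ι × Fin n → ℝ}
    (hm : ∀ v, p₀ (m v) = simplexVertex v.1 0) (hz : p₀ z = -1) :
    ∀ᶠ p in 𝓝 p₀, chessboardDegree (shiftOrbit p) m (shiftOrbit p z 0) =
      (n.factorial : ℤ) ^ Fintype.card ι := by
  have hcell : ∀ π, chessboardCell (shiftOrbit p₀) m π = standardCell π := fun π =>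
    funext fun v => by
      rw [chessboardCell, shiftOrbit, hm, simplexVertex_zero_vecMul_shift_pow, standardCell]
  have hpt : shiftOrbit p₀ z 0 = -1 := by rw [shiftOrbit_zero, hz]
  have hcont : ∀ π, Continuous fun p : Q → ι × Fin n → ℝ =>
      (chessboardCell (shiftOrbit p) m π).det := fun π =>
    Continuous.matrix_det (continuous_pi fun v => continuous_shiftOrbit _ _)
  have hcont' : ∀ π v, Continuous fun p : Q → ι × Fin n → ℝ =>
      ((chessboardCell (shiftOrbit p) m π).updateRow v (shiftOrbit p z 0)).det := fun π v =>
    Continuous.matrix_det ((continuous_pi fun v => continuous_shiftOrbit _ _).matrix_updateRow _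
      (continuous_shiftOrbit _ _))
  have key : ∀ π : ι → Equiv.Perm (Fin (n + 1)), ∀ᶠ p in 𝓝 p₀,
      cellSign π * captureSign (shiftOrbit p z 0) (chessboardCell (shiftOrbit p) m π) =
        propIndicator (∀ i, π i 0 = 0) := by
    intro π
    by_cases hπ : ∀ i, π i 0 = 0
    · obtain ⟨h1, h2⟩ := det_standardCell_of_fix π hπ
      rw [propIndicator_of_true hπ]
      have hsign : cellSign π = 1 ∨ cellSign π = -1 := by
        rw [← Int.isUnit_iff, cellSign, ← Units.coe_prod]
        exact Units.isUnit _
      rcases hsign with hs | hs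
      · have e1 : ∀ᶠ p in 𝓝 p₀, 0 < (chessboardCell (shiftOrbit p) m π).det :=
          (hcont π).continuousAt.eventually_const_lt (by simp [hcell, h1, hs])
        have e2 : ∀ᶠ p in 𝓝 p₀, ∀ v,
            ((chessboardCell (shiftOrbit p) m π).updateRow v (shiftOrbit p z 0)).det < 0 :=
          eventually_all.2 fun v => (hcont' π v).continuousAt.eventually_lt_const
            (by simp [hcell, hpt, h2, hs])
        filter_upwards [e1, e2] with p hp1 hp2
        rw [captureSign, propIndicator_of_true ⟨hp1, hp2⟩,
          propIndicator_of_false fun h => hp1.not_gt h.1, hs]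
        rfl
      · have e1 : ∀ᶠ p in 𝓝 p₀, (chessboardCell (shiftOrbit p) m π).det < 0 :=
          (hcont π).continuousAt.eventually_lt_const (by simp [hcell, h1, hs])
        have e2 : ∀ᶠ p in 𝓝 p₀, ∀ v,
            0 < ((chessboardCell (shiftOrbit p) m π).updateRow v (shiftOrbit p z 0)).det :=
          eventually_all.2 fun v => (hcont' π v).continuousAt.eventually_const_lt
            (by simp [hcell, hpt, h2, hs])
        filter_upwards [e1, e2] with p hp1 hp2
        rw [captureSign, propIndicator_of_true (P := _ ∧ ∀ v, 0 < _) ⟨hp1, hp2⟩,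
          propIndicator_of_false fun h => hp1.not_gt h.1, hs]
        rfl
    · obtain ⟨v, hv⟩ := det_standardCell_updateRow_of_not_fix π hπ
      rw [propIndicator_of_false hπ]
      have e : ∀ᶠ p in 𝓝 p₀, 0 < (chessboardCell (shiftOrbit p) m π).det *
          ((chessboardCell (shiftOrbit p) m π).updateRow v (shiftOrbit p z 0)).det :=
        ((hcont π).mul (hcont' π v)).continuousAt.eventually_const_lt (by
          simpa [hcell, hpt, hv] using det_standardCell_ne_zero π)
      filter_upwards [e] with p hp
      by_contra h
      exact hp.not_gt (det_mul_det_updateRow_neg_of_captureSign_ne_zero (right_ne_zero_of_mul h) v)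
  filter_upwards [eventually_all.2 key] with p hp
  rw [← card_perm_tuples_fix]
  exact Finset.sum_congr rfl fun π _ => hp π

theorem chessboardDegree_shiftOrbit_congr [Fact (n + 1).Prime]
    {p : (ι × Fin n) × Bool ⊕ Bool → ι × Fin n → ℝ} (hp : InGeneralPosition (shiftOrbit p)) :
    (chessboardDegree (shiftOrbit p) (fun v => .inl (v, true)) (shiftOrbit p (.inr true) 0) :
        ZMod (n + 1)) =
      chessboardDegree (shiftOrbit p) (fun v => .inl (v, false)) (shiftOrbit p (.inr false) 0) := by
  let m (S : Finset (ι × Fin n)) : ι × Fin n → (ι × Fin n) × Bool ⊕ Bool :=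
    fun v => .inl (v, decide (v ∈ S))
  have hm : ∀ S, Function.Injective (m S) := fun S v v' h => by
    simpa [m] using congrArg (Sum.elim Prod.fst fun _ => v) h
  have key : ∀ S, (chessboardDegree (shiftOrbit p) (m S) (shiftOrbit p (.inr false) 0) :
      ZMod (n + 1)) =
      chessboardDegree (shiftOrbit p) (m ∅) (shiftOrbit p (.inr false) 0) := by
    intro S
    induction S using Finset.induction_on with
    | empty => rfl
    | insert v S hv ih =>
      rw [← ih]
      have : m (insert v S) = Function.update (m S) v (.inl (v, true)) := by
        ext u : 1
        rcases eq_or_ne u v with rfl | hu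
        · simp [m]
        · simp [m, hu]
      rw [this]
      refine chessboardDegree_update hp (fun j => simplexShift ι n ^ (j : ℕ)) (fun j => ?_)
        (shiftOrbit_add p) (hm S) ?_ ?_ ?_ 0 v
      · rw [← pow_mul, mul_comm, pow_mul, simplexShift_pow, one_pow]
      · simp [m]
      · simp only [m, Set.mem_range, Sum.inl.injEq, Prod.mk.injEq, not_exists, not_and]
        rintro _ rfl
        simpa using hv
      · simp
  have huniv : m Finset.univ = fun v => .inl (v, true) := by simp [m]
  have hempty : m ∅ = fun v => .inl (v, false) := by simp [m]
  rw [← huniv, ← hempty, ← key Finset.univ, chessboardDegree_congr_point hp (hm _)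
    (z := .inr false) (z' := .inr true) (by simp [m]) (by simp [m]) (by simp) 0 0]

open Filter Topology in
/-- An equivariant form of the optimal colored Tverberg theorem. -/
theorem exists_zero_mem_convexHull_shift [Fact (n + 1).Prime] [Nonempty ι]
    (p : ι × Fin n → ι × Fin n → ℝ) (w : ι × Fin n → ℝ) :
    ∃ π : ι → Equiv.Perm (Fin (n + 1)), (0 : ι × Fin n → ℝ) ∈ convexHull ℝ (Set.range
      fun o : Option (ι × Fin n) => o.elim w
        fun v => Matrix.vecMul (p v) (simplexShift ι n ^ (π v.1 v.2.succ : ℕ))) := by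
  by_contra! hcon
  have hn : 0 < n := by
    have := (Fact.out : (n + 1).Prime).two_le
    omega
  have : Nonempty (Fin n) := ⟨⟨0, hn⟩⟩
  have hsep : ∀ π : ι → Equiv.Perm (Fin (n + 1)), ∃ l : StrongDual ℝ (ι × Fin n → ℝ), 0 < l w ∧
      ∀ v, 0 < l (Matrix.vecMul (p v) (simplexShift ι n ^ (π v.1 v.2.succ : ℕ))) := by
    intro π
    have hclosed : IsClosed (convexHull ℝ (Set.range fun o : Option (ι × Fin n) => o.elim w
        fun v => Matrix.vecMul (p v) (simplexShift ι n ^ (π v.1 v.2.succ : ℕ)))) :=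
      (Set.finite_range _).isClosed_convexHull ℝ
    obtain ⟨l, u, hu, hl⟩ := geometric_hahn_banach_point_closed (convex_convexHull ℝ _) hclosed
      (hcon π)
    rw [map_zero] at hu
    exact ⟨l, hu.trans (hl _ (subset_convexHull ℝ _ ⟨none, rfl⟩)),
      fun v => hu.trans (hl _ (subset_convexHull ℝ _ ⟨some v, rfl⟩))⟩
  choose l hlw hlp using hsep
  let p₀ : (ι × Fin n) × Bool ⊕ Bool → ι × Fin n → ℝ
    | .inl (v, false) => simplexVertex v.1 0
    | .inl (v, true) => p v
    | .inr false => -1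
    | .inr true => w
  have hbase := eventually_chessboardDegree_eq (m := fun v => .inl (v, false)) (z := .inr false)
    (p₀ := p₀) (fun v => rfl) rfl
  have hpos : ∀ᶠ q in 𝓝 p₀, ∀ π, 0 < l π (shiftOrbit q (.inr true) 0) ∧
      ∀ v, 0 < l π (shiftOrbit q (.inl (v, true)) (π v.1 v.2.succ)) := by
    refine eventually_all.2 fun π => (Continuous.continuousAt (by fun_prop)).eventually_const_lt ?_
      |>.and (eventually_all.2 fun v =>
        (Continuous.continuousAt (by fun_prop)).eventually_const_lt ?_)
    · rw [shiftOrbit_zero]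
      exact hlw π
    · exact hlp π v
  obtain ⟨q, ⟨hq1, hq2⟩, hq3⟩ :=
    mem_closure_iff_nhds.1 (dense_inGeneralPosition p₀) _ (hbase.and hpos)
  have hzero : chessboardDegree (shiftOrbit q) (fun v => .inl (v, true))
      (shiftOrbit q (.inr true) 0) = 0 :=
    Finset.sum_eq_zero fun π _ => mul_eq_zero_of_right _
      (captureSign_eq_zero_of_forall_pos (l π : (ι × Fin n → ℝ) →ₗ[ℝ] ℝ) (hq2 π).1 (hq2 π).2)
  have hdeg := chessboardDegree_shiftOrbit_congr hq3
  rw [hzero, hq1] at hdeg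
  push_cast at hdeg
  have h0 : ((n.factorial : ℕ) : ZMod (n + 1)) = 0 := eq_zero_of_pow_eq_zero hdeg.symm
  rw [ZMod.natCast_eq_zero_iff, (Fact.out : (n + 1).Prime).dvd_factorial] at h0
  omega

end Rainbow

theorem exists_sum_smul_eq_of_mem_convexHull_range {κ E : Type*} [Fintype κ] [AddCommGroup E]
    [Module ℝ E] {f : κ → E} {x : E} (hx : x ∈ convexHull ℝ (Set.range f)) :
    ∃ c : κ → ℝ, (∀ k, 0 ≤ c k) ∧ ∑ k, c k = 1 ∧ ∑ k, c k • f k = x := by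
  classical
  have hrange : Set.range f = Fintype.linearCombination ℝ f ''
      Set.range fun k : κ => (Pi.single k 1 : κ → ℝ) := by
    rw [← Set.range_comp]
    congr 1
    ext k
    simp
  rw [hrange, ← LinearMap.image_convexHull, convexHull_rangle_single_eq_stdSimplex] at hx
  obtain ⟨c, ⟨hc0, hc1⟩, hc⟩ := hx
  exact ⟨c, hc0, hc1, hc⟩

section Coloring

variable {ι : Type*} {n : ℕ}

/-- The coloring attached to `π` of the vertices of a simplex whose vertices other than `none` are
divided into classes of size `n`. Vertices of the same class have different colors. -/
def vertexColor (π : ι → Equiv.Perm (Fin (n + 1))) (o : Option (ι × Fin n)) : Fin (n + 1) :=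
  o.elim 0 fun v => π v.1 v.2.succ

/-- The optimal colored Tverberg theorem for cones. -/
theorem exists_vertexColor_sum_smul_eq [Fintype ι] [Nonempty ι] [Fact (n + 1).Prime]
    (y : Option (ι × Fin n) → ι → ℝ) :
    ∃ (π : ι → Equiv.Perm (Fin (n + 1))) (c : Option (ι × Fin n) → ℝ),
      (∀ o, 0 ≤ c o) ∧ ∑ o, c o = 1 ∧
      ∀ j, ∑ o with vertexColor π o = j, c o • y o = ∑ o with vertexColor π o = 0, c o • y o := by
  classical
  let lift (o : Option (ι × Fin n)) (j : Fin (n + 1)) : ι × Fin n → ℝ :=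
    ∑ i, y o i • simplexVertex i j
  have hlift : ∀ o i (t : Fin n) j,
      lift o j (i, t) = (if j = t.succ then y o i else 0) - if j = 0 then y o i else 0 := by
    intro o i t j
    simp only [lift, Finset.sum_apply, Pi.smul_apply, smul_eq_mul]
    rw [Finset.sum_eq_single i (fun k _ hk => by rw [simplexVertex_apply_of_ne hk.symm, mul_zero])
      (by simp)]
    refine Fin.cases ?_ (fun s => ?_) j
    · simp [simplexVertex_zero_apply, (Fin.succ_ne_zero t).symm]
    · by_cases hst : s = t
      · simp [simplexVertex_succ, hst]
      · simp [simplexVertex_succ, hst, Ne.symm hst]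
  obtain ⟨π, hπ⟩ := exists_zero_mem_convexHull_shift (fun v => lift (some v) 0) (lift none 0)
  obtain ⟨c, hc0, hc1, hc⟩ := exists_sum_smul_eq_of_mem_convexHull_range hπ
  refine ⟨π, c, hc0, hc1, fun j => ?_⟩
  have hrow : ∀ o : Option (ι × Fin n), (o.elim (lift none 0) fun v =>
      Matrix.vecMul (lift (some v) 0) (simplexShift ι n ^ (π v.1 v.2.succ : ℕ))) =
      lift o (vertexColor π o) := by
    rintro (_ | v)
    · rfl
    · simp [lift, vertexColor, Matrix.sum_vecMul, Matrix.smul_vecMul,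
        simplexVertex_zero_vecMul_shift_pow]
  simp only [hrow] at hc
  refine Fin.cases rfl (fun t => ?_) j
  ext i
  have := congrFun hc (i, t)
  simp only [Finset.sum_apply, Pi.smul_apply, hlift, smul_eq_mul, mul_sub, mul_ite, mul_zero,
    Finset.sum_sub_distrib, Pi.zero_apply, ← Finset.sum_filter] at this
  simpa [Finset.sum_apply] using sub_eq_zero.1 this

/-- The class of `i` contains all elements of a given small set of vertices, for a suitable
labelling of the vertices. -/
theorem exists_equiv_option_of_card_le [Fintype ι] {κ : Type*} [Fintype κ]
    (hcard : Fintype.card κ = Fintype.card (Option (ι × Fin n))) (i : ι) (μ : Finset κ)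
    (hμ : μ.card ≤ n) :
    ∃ e : κ ≃ Option (ι × Fin n), ∀ v ∈ μ, ∃ s, e v = some (i, s) := by
  classical
  obtain ⟨g⟩ : Nonempty (μ ↪ Fin n) := Function.Embedding.nonempty_of_card_le (by simpa)
  obtain ⟨e, he⟩ := Finset.exists_equiv_extend_of_card_eq (t := Finset.univ)
    (hcard.trans Finset.card_univ.symm) (s := μ)
    (f := fun v => if hv : v ∈ μ then some (i, g ⟨v, hv⟩) else none) (by simp)
    (fun v hv v' hv' h => by
      rw [Finset.mem_coe] at hv hv'
      simpa [hv, hv'] using h)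
  refine ⟨e.trans (Equiv.subtypeUnivEquiv Finset.mem_univ), fun v hv => ⟨g ⟨v, hv⟩, ?_⟩⟩
  simpa [hv] using he v hv

end Coloring

/-- Strengthening of the Tverberg plus minus theorem for primes `r`:
in addition, each face `σ j` contains at most one vertex of the distinguished face `μ`,
so in each affine representation of `b` at most one coefficient is non-positive.
Vertices of the simplex `Δ_N` are modeled by `Fin (N+1)`, faces by finsets of vertices,
and the affine map `a : Δ_N → ℝ^d` by its values on the vertices; `μ' = μᶜ`. -/
theorem tverberg_plus_minus_at_most_one_nonpositive
    (d r : ℕ) (hd : 1 ≤ d) (hr : 2 ≤ r) (hrp : r.Prime)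
    (N : ℕ) (hN : N = (r - 1) * (d + 1))
    (a : Fin (N + 1) → EuclideanSpace ℝ (Fin d))
    (μ : Finset (Fin (N + 1))) (hμcard : μ.card ≤ r - 1)
    (hsep : convexHull ℝ (a '' ↑μ) ∩ convexHull ℝ (a '' ↑μᶜ) = ∅) :
    ∃ (σ : Fin r → Finset (Fin (N + 1))) (b : EuclideanSpace ℝ (Fin d))
      (α : Fin (N + 1) → ℝ),
      (∀ j, (σ j).Nonempty) ∧
      (∀ j, σ j ≠ Finset.univ) ∧
      (∀ j k, j ≠ k → Disjoint (σ j) (σ k)) ∧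
      (∀ j, ∑ v ∈ σ j, α v • a v = b) ∧
      (∀ j, ∑ v ∈ σ j, α v = 1) ∧
      (∀ v, (∃ j, v ∈ σ j) → (v ∈ μ → α v ≤ 0) ∧ (v ∉ μ → 0 ≤ α v)) ∧
      (∀ j, (μ ∩ σ j).card ≤ 1) := by
  obtain ⟨n, rfl⟩ : ∃ n, r = n + 1 := ⟨r - 1, by omega⟩
  have : Fact (n + 1).Prime := ⟨hrp⟩
  rw [Nat.add_sub_cancel] at hN hμcard
  obtain ⟨e, he⟩ := exists_equiv_option_of_card_le (ι := Fin (d + 1)) (n := n)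
    (κ := Fin (N + 1)) (by simp [hN, mul_comm]) 0 μ hμcard
  obtain ⟨f, s, t, hfs, hst, hft⟩ := geometric_hahn_banach_compact_closed
    (convex_convexHull ℝ (a '' ↑μ)) ((μ.finite_toSet.image a).isCompact_convexHull ℝ)
    (convex_convexHull ℝ (a '' ↑μᶜ)) ((μᶜ.finite_toSet.image a).isClosed_convexHull ℝ)
    (Set.disjoint_iff_inter_eq_empty.2 hsep)
  let ε (v : Fin (N + 1)) : ℝ := if v ∈ μ then -1 else 1
  have hpos : ∀ v, 0 < ε v * (f (a v) - s) := by
    intro v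
    by_cases hv : v ∈ μ
    · simpa [ε, hv] using hfs _ (subset_convexHull ℝ _ ⟨v, hv, rfl⟩)
    · simpa [ε, hv] using hst.trans (hft _ (subset_convexHull ℝ _ ⟨v, by simpa using hv, rfl⟩))
  obtain ⟨π, c, hc0, hc1, hc⟩ := exists_vertexColor_sum_smul_eq fun o (i : Fin (d + 1)) =>
    ε (e.symm o) * Fin.cases 1 (fun k => a (e.symm o) k) i
  let σ (j : Fin (n + 1)) : Finset (Fin (N + 1)) := {v | vertexColor π (e v) = j}
  let β (v : Fin (N + 1)) : ℝ := ε v * c (e v)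
  have hreindex : ∀ j (i : Fin (d + 1)),
      ∑ v ∈ σ j, β v * Fin.cases (motive := fun _ => ℝ) 1 (fun k => a v k) i =
      ∑ v ∈ σ 0, β v * Fin.cases (motive := fun _ => ℝ) 1 (fun k => a v k) i := by
    intro j i
    have hj : ∀ j, ∑ v ∈ σ j, β v * Fin.cases (motive := fun _ => ℝ) 1 (fun k => a v k) i =
        (∑ o with vertexColor π o = j, c o • fun i : Fin (d + 1) => ε (e.symm o) *
          Fin.cases (motive := fun _ => ℝ) 1 (fun k => a (e.symm o) k) i) i := by
      intro j
      rw [Finset.sum_apply]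
      refine Finset.sum_equiv e (by simp [σ]) fun v _ => ?_
      simp only [β, Pi.smul_apply, smul_eq_mul, Equiv.symm_apply_apply]
      ring
    rw [hj, hj, hc]
  have hβ : ∀ j, ∑ v ∈ σ j, β v = ∑ v ∈ σ 0, β v := fun j => by simpa using hreindex j 0
  have hβa : ∀ j, ∑ v ∈ σ j, β v • a v = ∑ v ∈ σ 0, β v • a v := fun j => by
    ext k
    simpa using hreindex j k.succ
  have hcolor : ∀ v ∈ μ, ∀ j, v ∈ σ j → ∃ s, e v = some (0, s) ∧ π 0 s.succ = j := by
    intro v hv j hj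
    obtain ⟨s, hs⟩ := he v hv
    have hvj : vertexColor π (e v) = j := (Finset.mem_filter.1 hj).2
    exact ⟨s, hs, by rwa [hs] at hvj⟩
  have hmiss : ∀ v ∈ σ (π 0 0), 0 ≤ β v := by
    intro v hv
    have hvμ : v ∉ μ := by
      intro hvμ
      obtain ⟨s, -, hs⟩ := hcolor v hvμ _ hv
      exact Fin.succ_ne_zero s ((π 0).injective hs)
    simpa [β, ε, hvμ] using hc0 (e v)
  have htotal : 0 < ∑ v ∈ σ 0, β v := by
    rw [← hβ (π 0 0)]
    refine (Finset.sum_nonneg hmiss).lt_of_ne fun h0 => ?_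
    have hzero := (Finset.sum_eq_zero_iff_of_nonneg hmiss).1 h0.symm
    have hsum0 : ∀ j, ∑ v ∈ σ j, β v = 0 := fun j => by rw [hβ, ← hβ (π 0 0), ← h0]
    have hsuma0 : ∀ j, ∑ v ∈ σ j, β v • a v = 0 := fun j => by
      rw [hβa, ← hβa (π 0 0)]
      exact Finset.sum_eq_zero fun v hv => by rw [hzero v hv, zero_smul]
    have hf0 : ∑ v, β v * (f (a v) - s) = 0 := by
      rw [← Finset.sum_fiberwise (g := fun v => vertexColor π (e v))]
      refine Finset.sum_eq_zero fun j _ => ?_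
      have h1 := congrArg f (hsuma0 j)
      simp only [map_sum, map_smul, smul_eq_mul, map_zero] at h1
      simp only [mul_sub, Finset.sum_sub_distrib, ← Finset.sum_mul]
      rw [show ∑ v with vertexColor π (e v) = j, β v * f (a v) = 0 from h1,
        show ∑ v with vertexColor π (e v) = j, β v = 0 from hsum0 j, zero_mul, sub_zero]
    have hterm : ∀ v, β v * (f (a v) - s) = c (e v) * (ε v * (f (a v) - s)) := fun v => by
      simp only [β]
      ring
    simp only [hterm] at hf0
    rw [Finset.sum_eq_zero_iff_of_nonneg fun v _ => mul_nonneg (hc0 _) (hpos v).le] at hf0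
    have hc_zero : ∀ o, c o = 0 := fun o => by
      have := hf0 (e.symm o) (Finset.mem_univ _)
      simpa [(hpos (e.symm o)).ne'] using this
    simp [hc_zero] at hc1
  have hone : ∀ j, ∑ v ∈ σ j, β v / (∑ v ∈ σ 0, β v) = 1 := fun j => by
    rw [← Finset.sum_div, hβ, div_self htotal.ne']
  have hnonempty : ∀ j, (σ j).Nonempty := fun j =>
    Finset.nonempty_of_sum_ne_zero ((hone j).trans_ne one_ne_zero)
  have hdisj : ∀ j k, j ≠ k → Disjoint (σ j) (σ k) := fun j k hjk =>
    Finset.disjoint_filter.2 fun v _ hj hk => hjk (hj.symm.trans hk)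
  refine ⟨σ, (∑ v ∈ σ 0, β v)⁻¹ • ∑ v ∈ σ 0, β v • a v, fun v => β v / ∑ v ∈ σ 0, β v, hnonempty,
    fun j hj => ?_, hdisj, fun j => ?_, hone, fun v _ => ⟨fun hv => ?_, fun hv => ?_⟩, fun j => ?_⟩
  · have : Nontrivial (Fin (n + 1)) := Fin.nontrivial_iff_two_le.2 hr
    obtain ⟨k, hk⟩ := exists_ne j
    obtain ⟨v, hv⟩ := hnonempty k
    exact Finset.disjoint_left.1 (hdisj k j hk) hv (hj ▸ Finset.mem_univ v)
  · rw [← hβa j, Finset.smul_sum]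
    refine Finset.sum_congr rfl fun v _ => ?_
    simp only [smul_smul, div_eq_inv_mul]
  · refine div_nonpos_of_nonpos_of_nonneg ?_ htotal.le
    simpa [β, ε, hv] using hc0 (e v)
  · refine div_nonneg ?_ htotal.le
    simpa [β, ε, hv] using hc0 (e v)
  · refine Finset.card_le_one.2 fun v hv v' hv' => ?_
    rw [Finset.mem_inter] at hv hv'
    obtain ⟨s, hs, hsj⟩ := hcolor v hv.1 j hv.2
    obtain ⟨s', hs', hsj'⟩ := hcolor v' hv'.1 j hv'.2
    have : s = s' := Fin.succ_injective _ ((π 0).injective (hsj.trans hsj'.symm))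
    exact e.injective (by rw [hs, hs', this])
end
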